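/- arXiv:1508.06032 — 5 statements merged into one kernel-verified Lean document; each statement's English description precedes it below -/
import Mathlib

section
/- There exists a Nash equilibrium in mixed stopping strategies of type A for the simultaneous-move non-zero-sum stopping game: there is a pair (ρ*, τ*) ∈ 𝔗^{ar} × 𝔗^{ar} such that u^1(ρ, τ*) ≤ u^1(ρ*, τ*) for every ρ ∈ 𝔗^{ar} and u^2(ρ*, τ) ≤ u^2(ρ*, τ*) for every τ ∈ 𝔗^{ar}. -/
/-!
Statement 0: Existence of a Nash equilibrium in mixed stopping strategies of
type A for the simultaneous-move non-zero-sum stopping game.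
-/

open MeasureTheory Set

section

variable {Ω : Type*} {m0 : MeasurableSpace Ω} (μ : Measure Ω) (𝓕 : Filtration ℕ m0) (T : ℕ)

/-- `τ ∈ 𝒯`: a stopping time taking values in `{0,…,T}`. -/
def MemT (τ : Ω → ℕ) : Prop :=
  IsStoppingTime 𝓕 (fun ω => (τ ω : WithTop ℕ)) ∧ ∀ ω, τ ω ≤ T

/-- `τ ∈ 𝒯_{t+}`: a stopping time with `τ ≥ (t+1) ∧ T`. -/
def MemTgePlus (t : ℕ) (τ : Ω → ℕ) : Prop :=
  MemT 𝓕 T τ ∧ ∀ ω, min (t + 1) T ≤ τ ω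

/-- `φ ∈ 𝕋^a`: an adjustment map with `φ(t,·) ∈ 𝒯_{t+}` for every stage `t`. -/
def MemTTa (φ : ℕ → Ω → ℕ) : Prop :=
  ∀ t ≤ T, MemTgePlus 𝓕 T t (φ t)

/-- `α ∈ 𝒯^r`: a randomized stopping time, the randomization device being
`p ∈ [0,1]` (uniformly distributed). -/
def MemTr (α : ℝ → Ω → ℕ) : Prop :=
  Measurable (Function.uncurry α) ∧ ∀ p : ℝ, MemT 𝓕 T (α p)

/-- `ζ[η] = ζ₀ 1_{ζ₀ ≤ η₀} + ζ₁(η₀) 1_{ζ₀ > η₀}`. -/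
def adjS (ζ0 : Ω → ℕ) (ζ1 : ℕ → Ω → ℕ) (η0 : Ω → ℕ) : Ω → ℕ :=
  fun ω => if ζ0 ω ≤ η0 ω then ζ0 ω else ζ1 (η0 ω) ω

/-- `Γ(ζ,η) = E[U(ζ[η], η[ζ])]` for pure strategies `ζ = (ζ0,ζ1)`, `η = (η0,η1)`. -/
noncomputable def Gam (U : ℕ → ℕ → Ω → ℝ) (ζ0 : Ω → ℕ) (ζ1 : ℕ → Ω → ℕ)
    (η0 : Ω → ℕ) (η1 : ℕ → Ω → ℕ) : ℝ :=
  ∫ ω, U (adjS ζ0 ζ1 η0 ω) (adjS η0 η1 ζ0 ω) ω ∂μ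

/-- `u(ρ,τ) = ∫∫ Γ((α(p,·),ρ₁),(β(q,·),τ₁)) dp dq` for mixed type-A strategies
`ρ = (α,ρ₁)`, `τ = (β,τ₁)`. -/
noncomputable def uPay (U : ℕ → ℕ → Ω → ℝ) (α : ℝ → Ω → ℕ) (ρ1 : ℕ → Ω → ℕ)
    (β : ℝ → Ω → ℕ) (τ1 : ℕ → Ω → ℕ) : ℝ :=
  ∫ p in Icc (0:ℝ) 1, ∫ q in Icc (0:ℝ) 1, Gam μ U (α p) ρ1 (β q) τ1

lemma MemT_iff {τ : Ω → ℕ} :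
    MemT 𝓕 T τ ↔ (∀ i, MeasurableSet[𝓕 i] {ω | τ ω ≤ i}) ∧ ∀ ω, τ ω ≤ T := by
  unfold MemT IsStoppingTime
  simp

lemma MemT.eqS {τ : Ω → ℕ} (h : MemT 𝓕 T τ) (i : ℕ) : MeasurableSet[𝓕 i] {ω | τ ω = i} := by
  simpa using h.1.measurableSet_eq i

lemma MemT.gtS {τ : Ω → ℕ} (h : MemT 𝓕 T τ) (i : ℕ) : MeasurableSet[𝓕 i] {ω | i < τ ω} := by
  have := (((MemT_iff 𝓕 T).1 h).1 i).compl
  convert this using 1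
  ext ω; simp

lemma MemT.geS {τ : Ω → ℕ} (h : MemT 𝓕 T τ) (i : ℕ) : MeasurableSet[𝓕 i] {ω | i ≤ τ ω} := by
  have := (h.eqS 𝓕 T i).union (h.gtS 𝓕 T i)
  convert this using 1
  ext ω; simp; omega

lemma MemT.meas {τ : Ω → ℕ} (h : MemT 𝓕 T τ) : Measurable τ :=
  measurable_of_Iic fun i => 𝓕.le i _ (((MemT_iff 𝓕 T).1 h).1 i)

lemma meas_comp {X : Type*} [MeasurableSpace X] (U : ℕ → ℕ → Ω → ℝ)
    (hU : ∀ s t, Measurable (U s t)) (a b : X → ℕ) (c : X → Ω) (ha : Measurable a)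
    (hb : Measurable b) (hc : Measurable c) : Measurable fun x => U (a x) (b x) (c x) := by
  have : Measurable fun z : (ℕ × ℕ) × Ω => U z.1.1 z.1.2 z.2 :=
    measurable_from_prod_countable_right fun z => hU z.1 z.2
  exact this.comp ((ha.prodMk hb).prodMk hc)

lemma meas_comp1 {X : Type*} [MeasurableSpace X] (φ : ℕ → Ω → ℕ)
    (hU : ∀ s, Measurable (φ s)) (a : X → ℕ) (c : X → Ω) (ha : Measurable a)
    (hc : Measurable c) : Measurable fun x => φ (a x) (c x) := by
  have : Measurable fun z : ℕ × Ω => φ z.1 z.2 :=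
    measurable_from_prod_countable_right fun z => hU z
  exact this.comp (ha.prodMk hc)

/-- bounded weight, measurable w.r.t. `m` -/
def Wt (m : MeasurableSpace Ω) (f : Ω → ℝ) : Prop := Measurable[m] f ∧ ∀ ω, 0 ≤ f ω ∧ f ω ≤ 1

lemma Wt.mul {m : MeasurableSpace Ω} {f g : Ω → ℝ} (hf : Wt m f) (hg : Wt m g) :
    Wt m (fun ω => f ω * g ω) :=
  ⟨hf.1.mul hg.1, fun ω => ⟨mul_nonneg (hf.2 ω).1 (hg.2 ω).1,
    mul_le_one₀ (hf.2 ω).2 (hg.2 ω).1 (hg.2 ω).2⟩⟩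

lemma Wt.mono {m m' : MeasurableSpace Ω} {f : Ω → ℝ} (hf : Wt m f) (h : m ≤ m') : Wt m' f :=
  ⟨hf.1.mono h le_rfl, hf.2⟩

lemma Wt.ind {m : MeasurableSpace Ω} {s : Set Ω} (hs : MeasurableSet[m] s) :
    Wt m (s.indicator 1) := by
  refine ⟨measurable_one.indicator hs, fun ω => ?_⟩
  by_cases h : ω ∈ s <;> simp [h]

lemma Wt.compl {m : MeasurableSpace Ω} {f : Ω → ℝ} (hf : Wt m f) :
    Wt m (fun ω => 1 - f ω) :=
  ⟨measurable_const.sub hf.1, fun ω => by have := hf.2 ω; constructor <;> linarith⟩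

lemma Wt.int {f g : Ω → ℝ} (hf : Wt m0 f) (hg : Integrable g μ) :
    Integrable (fun ω => f ω * g ω) μ :=
  hg.bdd_mul (c := 1) hf.1.aestronglyMeasurable
    (Filter.Eventually.of_forall fun ω => by rw [Real.norm_of_nonneg (hf.2 ω).1]; exact (hf.2 ω).2)

lemma int_condExp [IsProbabilityMeasure μ] {m : MeasurableSpace Ω} (hm : m ≤ m0) {f g : Ω → ℝ}
    (hf : Wt m f) (hg : Integrable g μ) :
    ∫ ω, f ω * g ω ∂μ = ∫ ω, f ω * (μ[g | m]) ω ∂μ := by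
  rw [← integral_condExp hm]
  apply integral_congr_ae
  exact condExp_mul_of_stronglyMeasurable_left hf.1.stronglyMeasurable
    ((hf.mono hm).int μ hg) hg

lemma snell_exists [IsProbabilityMeasure μ] (g : ℕ → Ω → ℝ) (C : ℝ) (hb : ∀ s ω, |g s ω| ≤ C)
    (n : ℕ) (hn : n ≤ T) (hg : ∀ s, n ≤ s → Measurable[𝓕 s] (g s)) :
    ∃ σ, MemT 𝓕 T σ ∧ (∀ ω, n ≤ σ ω) ∧ ∀ σ', MemT 𝓕 T σ' → (∀ ω, n ≤ σ' ω) →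
      ∀ f, Wt (𝓕 n) f → ∫ ω, f ω * g (σ' ω) ω ∂μ ≤ ∫ ω, f ω * g (σ ω) ω ∂μ := by
  have hint : ∀ n, (∀ s, n ≤ s → Measurable[𝓕 s] (g s)) → ∀ σ, MemT 𝓕 T σ → (∀ ω, n ≤ σ ω) →
      Integrable (fun ω => g (σ ω) ω) μ := by
    intro n hg σ hσ hn
    refine Integrable.of_bound (Measurable.aestronglyMeasurable ?_) C
      (Filter.Eventually.of_forall fun ω => by simpa using hb _ _)
    have := meas_comp (fun s _ => g (max s n))
      (fun s _ => (hg _ (le_max_right _ _)).mono (𝓕.le _) le_rfl) σ σ id (hσ.meas 𝓕 T)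
      (hσ.meas 𝓕 T) measurable_id
    simpa [hn] using this
  induction hn using Nat.decreasingInduction with
  | self =>
    refine ⟨fun _ => T, ?_, fun _ => le_rfl, ?_⟩
    · rw [MemT_iff]; exact ⟨fun i => MeasurableSet.const _, fun _ => le_rfl⟩
    · intro σ' h1 h2 f hf
      have : σ' = fun _ => T := funext fun ω => le_antisymm (h1.2 ω) (h2 ω)
      rw [this]
  | of_succ n hn ih =>
    obtain ⟨σ, hσ, hσn, hopt⟩ := ih (fun s hs => hg s (by omega))
    have hi := hint (n+1) (fun s hs => hg s (by omega)) σ hσ hσn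
    set c := μ[fun ω => g (σ ω) ω | 𝓕 n] with hc
    have hcm : Measurable[𝓕 n] c := stronglyMeasurable_condExp.measurable
    have hS : MeasurableSet[𝓕 n] {ω | c ω ≤ g n ω} :=
      measurableSet_le hcm (hg n le_rfl)
    classical
    have hσ' : MemT 𝓕 T (fun ω => if c ω ≤ g n ω then n else σ ω) := by
      rw [MemT_iff]
      constructor
      · intro i
        by_cases hin : n ≤ i
        · have h1 := (𝓕.mono hin _ hS).union (((MemT_iff 𝓕 T).1 hσ).1 i)
          have h2 : {ω | (if c ω ≤ g n ω then n else σ ω) ≤ i} =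
            {ω | c ω ≤ g n ω} ∪ {ω | σ ω ≤ i} := by
            ext ω; simp only [mem_ofPred_eq, mem_union]; split_ifs with h <;> simp [h, hin]
          rw [h2]; exact h1
        · have h2 : {ω | (if c ω ≤ g n ω then n else σ ω) ≤ i} = ∅ := by
            ext ω; have := hσn ω
            simp only [mem_ofPred_eq, mem_empty_iff_false, iff_false]; split_ifs <;> omega
          rw [h2]; exact @MeasurableSet.empty _ (𝓕 i)
      · intro ω; have := hσ.2 ω; split_ifs <;> omega
    refine ⟨_, hσ', ?_, ?_⟩
    · intro ω; have := hσn ω; split_ifs <;> omega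
    intro τ hτ hτn f hf
    have hgi : Integrable (g n) μ := by
      refine Integrable.of_bound ((hg n le_rfl).mono (𝓕.le n) le_rfl).aestronglyMeasurable C
        (Filter.Eventually.of_forall fun ω => by simpa using hb _ _)
    have hτ2 : MemT 𝓕 T (fun ω => max (τ ω) (n+1)) := by
      rw [MemT_iff]
      refine ⟨fun i => ?_, fun ω => max_le (hτ.2 ω) hn⟩
      by_cases hin : n + 1 ≤ i
      · simpa [hin] using ((MemT_iff 𝓕 T).1 hτ).1 i
      · have : {ω | max (τ ω) (n+1) ≤ i} = ∅ := by ext ω; simp; omega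
        rw [this]; exact @MeasurableSet.empty _ (𝓕 i)
    have hi2 := hint (n+1) (fun s hs => hg s (by omega)) _ hτ2 (fun ω => le_max_right _ _)
    have w1 := hf.mul (Wt.ind (hτ.eqS 𝓕 T n))
    have w2 := hf.mul (Wt.ind (hτ.gtS 𝓕 T n))
    have w3 := hf.mul (Wt.ind hS)
    have w4 := hf.mul (Wt.ind hS.compl)
    have m1 := 𝓕.le n
    have ci : Integrable c μ := integrable_condExp
    calc ∫ ω, f ω * g (τ ω) ω ∂μ
        = ∫ ω, ((f ω * {ω | τ ω = n}.indicator 1 ω) * g n ω +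
            (f ω * {ω | n < τ ω}.indicator 1 ω) * g (max (τ ω) (n+1)) ω) ∂μ := by
          congr 1; ext ω
          rcases (hτn ω).eq_or_lt with h | h
          · simp [← h]
          · simp [h, h.ne']
      _ = ∫ ω, (f ω * {ω | τ ω = n}.indicator 1 ω) * g n ω ∂μ +
            ∫ ω, (f ω * {ω | n < τ ω}.indicator 1 ω) * g (max (τ ω) (n+1)) ω ∂μ :=
          integral_add ((w1.mono m1).int μ hgi) ((w2.mono m1).int μ hi2)
      _ ≤ ∫ ω, (f ω * {ω | τ ω = n}.indicator 1 ω) * g n ω ∂μ +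
            ∫ ω, (f ω * {ω | n < τ ω}.indicator 1 ω) * c ω ∂μ := by
          rw [← int_condExp μ m1 w2 hi]
          gcongr 1
          exact hopt _ hτ2 (fun ω => le_max_right _ _) _ (w2.mono (𝓕.mono (Nat.le_succ n)))
      _ = ∫ ω, ((f ω * {ω | τ ω = n}.indicator 1 ω) * g n ω +
            (f ω * {ω | n < τ ω}.indicator 1 ω) * c ω) ∂μ :=
          (integral_add ((w1.mono m1).int μ hgi) ((w2.mono m1).int μ ci)).symm
      _ ≤ ∫ ω, ((f ω * {ω | c ω ≤ g n ω}.indicator 1 ω) * g n ω +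
            (f ω * {ω | c ω ≤ g n ω}ᶜ.indicator 1 ω) * c ω) ∂μ := by
          apply integral_mono (((w1.mono m1).int μ hgi).add ((w2.mono m1).int μ ci))
            (((w3.mono m1).int μ hgi).add ((w4.mono m1).int μ ci))
          intro ω
          have hf0 := (hf.2 ω).1
          dsimp only
          rcases (hτn ω).eq_or_lt with h | h <;> by_cases h' : c ω ≤ g n ω
          · simp [← h, h']
          · simp [← h, h']; push Not at h'; gcongr
          · simp [h, h.ne', h']; gcongr
          · simp [h, h.ne', h']
      _ = ∫ ω, (f ω * {ω | c ω ≤ g n ω}.indicator 1 ω) * g n ω ∂μ +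
            ∫ ω, (f ω * {ω | c ω ≤ g n ω}ᶜ.indicator 1 ω) * g (σ ω) ω ∂μ := by
          rw [int_condExp μ m1 w4 hi]
          exact integral_add ((w3.mono m1).int μ hgi) ((w4.mono m1).int μ ci)
      _ = _ := by
          rw [← integral_add ((w3.mono m1).int μ hgi) ((w4.mono m1).int μ hi)]
          congr 1; ext ω
          by_cases h' : c ω ≤ g n ω <;> simp [h']


lemma meas_K (U : ℕ → ℕ → Ω → ℝ) (hU : ∀ s t, Measurable (U s t))
    {α : ℝ → Ω → ℕ} {ρ1 : ℕ → Ω → ℕ} {β : ℝ → Ω → ℕ} {τ1 : ℕ → Ω → ℕ}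
    (hα : MemTr 𝓕 T α) (hρ : MemTTa 𝓕 T ρ1) (hβ : MemTr 𝓕 T β) (hτ : MemTTa 𝓕 T τ1) :
    Measurable (fun z : (ℝ × ℝ) × Ω => U (adjS (α z.1.1) ρ1 (β z.1.2) z.2)
      (adjS (β z.1.2) τ1 (α z.1.1) z.2) z.2) := by
  have ha : Measurable fun z : (ℝ × ℝ) × Ω => α z.1.1 z.2 :=
    hα.1.comp ((measurable_fst.comp measurable_fst).prodMk measurable_snd)
  have hb : Measurable fun z : (ℝ × ℝ) × Ω => β z.1.2 z.2 :=
    hβ.1.comp ((measurable_snd.comp measurable_fst).prodMk measurable_snd)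
  have key : ∀ (φ : ℕ → Ω → ℕ), MemTTa 𝓕 T φ → ∀ a b : (ℝ × ℝ) × Ω → ℕ, Measurable a →
      Measurable b → (∀ z, b z ≤ T) →
      Measurable fun z : (ℝ × ℝ) × Ω => if a z ≤ b z then a z else φ (b z) z.2 := by
    intro φ hφ a b ha hb hT
    refine Measurable.ite (measurableSet_le ha hb) ha ?_
    have := meas_comp1 (fun t => φ (min t T))
      (fun t => ((hφ _ (min_le_right _ _)).1.meas 𝓕 T)) b Prod.snd hb measurable_snd
    simpa [hT] using this
  exact meas_comp U hU _ _ _ (key ρ1 hρ _ _ ha hb fun z => (hβ.2 _).2 _)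
    (key τ1 hτ _ _ hb ha fun z => (hα.2 _).2 _) measurable_snd

lemma Gam_swap (U : ℕ → ℕ → Ω → ℝ) (ζ0 : Ω → ℕ) (ζ1 : ℕ → Ω → ℕ)
    (η0 : Ω → ℕ) (η1 : ℕ → Ω → ℕ) :
    Gam μ U ζ0 ζ1 η0 η1 = Gam μ (fun s t => U t s) η0 η1 ζ0 ζ1 := rfl

lemma int_Gam [IsProbabilityMeasure μ] (U : ℕ → ℕ → Ω → ℝ) (hU : ∀ s t, Measurable (U s t))
    (C : ℝ) (hb : ∀ s t ω, |U s t ω| ≤ C)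
    {α : ℝ → Ω → ℕ} {ρ1 : ℕ → Ω → ℕ} {β : ℝ → Ω → ℕ} {τ1 : ℕ → Ω → ℕ}
    (hα : MemTr 𝓕 T α) (hρ : MemTTa 𝓕 T ρ1) (hβ : MemTr 𝓕 T β) (hτ : MemTTa 𝓕 T τ1) :
    Integrable (Function.uncurry fun p q => Gam μ U (α p) ρ1 (β q) τ1)
      ((volume.restrict (Icc (0:ℝ) 1)).prod (volume.restrict (Icc (0:ℝ) 1))) := by
  have h := meas_K 𝓕 T U hU hα hρ hβ hτ
  have h2 : Integrable (fun z : (ℝ × ℝ) × Ω => U (adjS (α z.1.1) ρ1 (β z.1.2) z.2)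
      (adjS (β z.1.2) τ1 (α z.1.1) z.2) z.2)
      (((volume.restrict (Icc (0:ℝ) 1)).prod (volume.restrict (Icc (0:ℝ) 1))).prod μ) :=
    Integrable.of_bound h.aestronglyMeasurable C
      (Filter.Eventually.of_forall fun ω => by simpa using hb _ _ _)
  exact h2.integral_prod_left

lemma uPay_swap [IsProbabilityMeasure μ] (U : ℕ → ℕ → Ω → ℝ) (hU : ∀ s t, Measurable (U s t))
    (C : ℝ) (hb : ∀ s t ω, |U s t ω| ≤ C)
    {α : ℝ → Ω → ℕ} {ρ1 : ℕ → Ω → ℕ} {β : ℝ → Ω → ℕ} {τ1 : ℕ → Ω → ℕ}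
    (hα : MemTr 𝓕 T α) (hρ : MemTTa 𝓕 T ρ1) (hβ : MemTr 𝓕 T β) (hτ : MemTTa 𝓕 T τ1) :
    uPay μ U α ρ1 β τ1 = uPay μ (fun s t => U t s) β τ1 α ρ1 :=
  integral_integral_swap (int_Gam μ 𝓕 T U hU C hb hα hρ hβ hτ)

lemma Gam_fubini [IsProbabilityMeasure μ] (U : ℕ → ℕ → Ω → ℝ) (hU : ∀ s t, Measurable (U s t))
    (C : ℝ) (hb : ∀ s t ω, |U s t ω| ≤ C)
    {ζ : Ω → ℕ} {ρ1 : ℕ → Ω → ℕ} {β : ℝ → Ω → ℕ} {τ1 : ℕ → Ω → ℕ}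
    (hζ : MemT 𝓕 T ζ) (hρ : MemTTa 𝓕 T ρ1) (hβ : MemTr 𝓕 T β) (hτ : MemTTa 𝓕 T τ1) :
    ∫ q in Icc (0:ℝ) 1, Gam μ U ζ ρ1 (β q) τ1 = ∫ ω, (∫ q in Icc (0:ℝ) 1,
      U (adjS ζ ρ1 (β q) ω) (adjS (β q) τ1 ζ ω) ω) ∂μ := by
  have hα : MemTr 𝓕 T (fun _ => ζ) := ⟨(hζ.meas 𝓕 T).comp measurable_snd, fun _ => hζ⟩
  have h := meas_K 𝓕 T U hU hα hρ hβ hτ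
  have h1 : Measurable (fun z : ℝ × Ω => U (adjS ζ ρ1 (β z.1) z.2)
      (adjS (β z.1) τ1 ζ z.2) z.2) :=
    h.comp (f := fun z : ℝ × Ω => (((0 : ℝ), z.1), z.2)) (by fun_prop)
  apply integral_integral_swap
  exact Integrable.of_bound h1.aestronglyMeasurable C
      (Filter.Eventually.of_forall fun ω => hb _ _ _)

/-- survival probability -/
def Rr (q : ℕ → Ω → ℝ) (t : ℕ) (ω : Ω) : ℝ := ∏ s ∈ Finset.range t, (1 - q s ω)

lemma Rr_succ (q : ℕ → Ω → ℝ) (t : ℕ) (ω : Ω) : Rr q (t+1) ω = Rr q t ω * (1 - q t ω) :=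
  Finset.prod_range_succ _ _

lemma Rr_Wt {q : ℕ → Ω → ℝ} (hq : ∀ t ≤ T, Wt (𝓕 t) (q t)) (n t : ℕ) (h : t ≤ n + 1)
    (hn : n ≤ T) : Wt (𝓕 n) (Rr q t) := by
  induction t with
  | zero => exact ⟨by unfold Rr; simp, fun ω => by simp [Rr]⟩
  | succ t ih =>
    have := (ih (by omega)).mul ((hq t (by omega)).mono (𝓕.mono (by omega : t ≤ n))).compl
    convert this using 1
    ext ω; exact Rr_succ _ _ _

lemma Rr_anti {q : ℕ → Ω → ℝ} (hq : ∀ t ≤ T, Wt (𝓕 t) (q t)) {s t : ℕ} (h : s ≤ t)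
    (ht : t ≤ T + 1) (ω : Ω) : Rr q t ω ≤ Rr q s ω := by
  induction h with
  | refl => rfl
  | step h ih =>
    rename_i m
    refine le_trans ?_ (ih (by omega))
    rw [Rr_succ]
    have h1 := ((Rr_Wt 𝓕 T hq T m (by omega) le_rfl).2 ω).1
    have h2 := (hq m (by omega)).2 ω
    nlinarith

open Classical in
/-- randomized stopping time built from the hazard rates `q` -/
noncomputable def rst (q : ℕ → Ω → ℝ) (p : ℝ) (ω : Ω) : ℕ :=
  Nat.find (⟨T, Or.inr le_rfl⟩ : ∃ t, Rr q (t+1) ω ≤ 1 - p ∨ T ≤ t)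

lemma rst_le {q : ℕ → Ω → ℝ} (hq : ∀ t ≤ T, Wt (𝓕 t) (q t)) (p : ℝ) (ω : Ω) (t : ℕ) :
    rst T q p ω ≤ t ↔ (Rr q (t+1) ω ≤ 1 - p ∨ T ≤ t) := by
  unfold rst
  rw [Nat.find_le_iff]
  constructor
  · rintro ⟨m, hm, h⟩
    by_cases ht : T ≤ t
    · exact Or.inr ht
    · rcases h with h | h
      · exact Or.inl ((Rr_anti 𝓕 T hq (by omega) (by omega) ω).trans h)
      · omega
  · exact fun h => ⟨t, le_rfl, h⟩

lemma rst_MemTr {q : ℕ → Ω → ℝ} (hq : ∀ t ≤ T, Wt (𝓕 t) (q t)) : MemTr 𝓕 T (rst T q) := by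
  constructor
  · refine measurable_of_Iic fun t => ?_
    have : (Function.uncurry (rst T q)) ⁻¹' Iic t =
      {z : ℝ × Ω | Rr q (t+1) z.2 ≤ 1 - z.1 ∨ T ≤ t} := by
      ext ⟨p, ω⟩; simp [rst_le 𝓕 T hq]
    rw [this]
    by_cases h : T ≤ t
    · simp [h]
    · simp only [h, or_false]
      have := ((Rr_Wt 𝓕 T hq t (t+1) le_rfl (by omega)).mono (𝓕.le t)).1
      exact measurableSet_le (this.comp measurable_snd) (measurable_const.sub measurable_fst)
  · intro p
    rw [MemT_iff]
    constructor
    · intro t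
      simp only [rst_le 𝓕 T hq]
      by_cases h : T ≤ t
      · simp [h]
      · simp only [h, or_false]
        exact measurableSet_le (Rr_Wt 𝓕 T hq t (t+1) le_rfl (by omega)).1 measurable_const
    · intro ω; rw [rst_le 𝓕 T hq]; exact Or.inr le_rfl

lemma rst_eq {q : ℕ → Ω → ℝ} (hq : ∀ t ≤ T, Wt (𝓕 t) (q t)) (hqT : ∀ ω, q T ω = 1)
    {p : ℝ} (hp : p ∈ Ioc (0:ℝ) 1) (ω : Ω) {t : ℕ} (ht : t ≤ T) :
    rst T q p ω = t ↔ p ∈ Ioc (1 - Rr q t ω) (1 - Rr q (t+1) ω) := by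
  have h1 : rst T q p ω ≤ t ↔ p ≤ 1 - Rr q (t+1) ω := by
    rw [rst_le 𝓕 T hq]
    rcases ht.eq_or_lt with rfl | h
    · have : Rr q (t+1) ω = 0 := by rw [Rr_succ, hqT]; simp
      simp [this, hp.2]
    · constructor
      · rintro (h' | h') <;> [linarith; omega]
      · intro; left; linarith
  have h2 : t ≤ rst T q p ω ↔ 1 - Rr q t ω < p := by
    rcases t with _ | t
    · simp [Rr, hp.1]
    · rw [Nat.succ_le_iff, ← not_le, rst_le 𝓕 T hq, not_or]
      constructor
      · rintro ⟨h, -⟩; linarith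
      · intro h; exact ⟨by linarith, by omega⟩
  rw [mem_Ioc, ← h1, ← h2]; omega

lemma rst_supp {q : ℕ → Ω → ℝ} (hq : ∀ t ≤ T, Wt (𝓕 t) (q t)) (hqT : ∀ ω, q T ω = 1)
    {p : ℝ} (hp : p ∈ Ioc (0:ℝ) 1) (ω : Ω) {t : ℕ} (ht : t < T) :
    (rst T q p ω = t → 0 < q t ω) ∧ (t < rst T q p ω → q t ω < 1) := by
  have hq' := (hq t ht.le).2 ω
  constructor
  · intro h
    rw [rst_eq 𝓕 T hq hqT hp ω ht.le, Rr_succ] at h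
    refine lt_of_le_of_ne hq'.1 fun h0 => ?_
    rw [← h0] at h
    simp at h
  · intro h
    rw [← not_le, rst_le 𝓕 T hq, not_or, Rr_succ] at h
    refine lt_of_le_of_ne hq'.2 fun h0 => ?_
    rw [h0] at h
    have := hp.2
    simp at h
    linarith [h.1]

lemma rst_int {q : ℕ → Ω → ℝ} (hq : ∀ t ≤ T, Wt (𝓕 t) (q t)) (hqT : ∀ ω, q T ω = 1)
    (ω : Ω) (h : ℕ → ℝ) :
    ∫ p in Icc (0:ℝ) 1, h (rst T q p ω) =
      ∑ t ∈ Finset.range (T+1), Rr q t ω * q t ω * h t := by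
  rw [integral_Icc_eq_integral_Ioc]
  have h1 : ∫ p in Ioc (0:ℝ) 1, h (rst T q p ω) = ∫ p in Ioc (0:ℝ) 1,
      ∑ t ∈ Finset.range (T+1), (Ioc (1 - Rr q t ω) (1 - Rr q (t+1) ω)).indicator
        (fun _ => h t) p := by
    refine setIntegral_congr_fun measurableSet_Ioc fun p hp => ?_
    have hle : rst T q p ω ≤ T := by rw [rst_le 𝓕 T hq]; exact Or.inr le_rfl
    rw [Finset.sum_eq_single (rst T q p ω)]
    · rw [indicator_of_mem]
      exact (rst_eq 𝓕 T hq hqT hp ω hle).1 rfl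
    · intro t ht hne
      rw [indicator_of_notMem]
      intro hh
      exact hne ((rst_eq 𝓕 T hq hqT hp ω (by simp at ht; omega)).2 hh).symm
    · intro hh; simp at hh; omega
  rw [h1, integral_finsetSum]
  · refine Finset.sum_congr rfl fun t ht => ?_
    have ht' : t ≤ T := by simp at ht; omega
    have e1 := (Rr_Wt 𝓕 T hq T t (by omega) le_rfl).2 ω
    have e2 := (Rr_Wt 𝓕 T hq T (t+1) (by omega) le_rfl).2 ω
    have e3 := Rr_anti 𝓕 T hq (Nat.le_succ t) (by omega) ω
    rw [integral_indicator measurableSet_Ioc, Measure.restrict_restrict measurableSet_Ioc,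
      Ioc_inter_Ioc, setIntegral_const, max_eq_left (by linarith), min_eq_left (by linarith)]
    rw [Real.volume_real_Ioc_of_le (by linarith), Rr_succ, smul_eq_mul]
    ring
  · intro t ht
    exact (integrable_const _).indicator measurableSet_Ioc

/-- sign of best response -/
def BR (D p : ℝ) : Prop := 0 ≤ p ∧ p ≤ 1 ∧ (0 < p → 0 ≤ D) ∧ (p < 1 → D ≤ 0)

open Classical in
noncomputable def sel (A B A' B' : ℝ) : ℝ × ℝ :=
  if 0 ≤ A ∧ 0 ≤ A' then (1, 1) else
  if B ≤ 0 ∧ B' ≤ 0 then (0, 0) else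
  if 0 ≤ B ∧ A' ≤ 0 then (1, 0) else
  if A ≤ 0 ∧ 0 ≤ B' then (0, 1) else
  (B' / (B' - A'), B / (B - A))

lemma mixed_aux {A B : ℝ} (h : (0 ≤ A ∧ B < 0) ∨ (A < 0 ∧ 0 < B)) :
    0 ≤ B / (B - A) ∧ B / (B - A) ≤ 1 ∧ B / (B-A) * A + (1 - B / (B-A)) * B = 0 := by
  rcases h with ⟨h1, h2⟩ | ⟨h1, h2⟩
  · have : B - A < 0 := by linarith
    refine ⟨div_nonneg_of_nonpos h2.le this.le, ?_, ?_⟩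
    · rw [div_le_one_of_neg this]; linarith
    · field_simp [this.ne]; ring
  · have : 0 < B - A := by linarith
    refine ⟨div_nonneg h2.le this.le, ?_, ?_⟩
    · rw [div_le_one this]; linarith
    · field_simp [this.ne']; ring

lemma sel_spec (A B A' B' : ℝ) :
    BR ((sel A B A' B').2 * A + (1 - (sel A B A' B').2) * B) (sel A B A' B').1 ∧
    BR ((sel A B A' B').1 * A' + (1 - (sel A B A' B').1) * B') (sel A B A' B').2 := by
  unfold sel BR
  split_ifs with h1 h2 h3 h4
  · simp; exact h1
  · simp; exact h2
  · simp; exact h3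
  · simp; exact h4
  · rw [not_and_or] at h1 h2 h3 h4
    push Not at h1 h2 h3 h4
    have k1 : (0 ≤ A ∧ B < 0) ∨ (A < 0 ∧ 0 < B) := by
      rcases h1 with h1 | h1 <;> rcases h2 with h2 | h2 <;> rcases h3 with h3 | h3 <;>
        rcases h4 with h4 | h4 <;> first | (exfalso; linarith) | (left; constructor <;> linarith) | (right; constructor <;> linarith)
    have k2 : (0 ≤ A' ∧ B' < 0) ∨ (A' < 0 ∧ 0 < B') := by
      rcases h1 with h1 | h1 <;> rcases h2 with h2 | h2 <;> rcases h3 with h3 | h3 <;>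
        rcases h4 with h4 | h4 <;> first | (exfalso; linarith) | (left; constructor <;> linarith) | (right; constructor <;> linarith)
    obtain ⟨a1, a2, a3⟩ := mixed_aux k1
    obtain ⟨b1, b2, b3⟩ := mixed_aux k2
    dsimp only
    rw [a3, b3]
    exact ⟨⟨b1, b2, fun _ => le_rfl, fun _ => le_rfl⟩, ⟨a1, a2, fun _ => le_rfl, fun _ => le_rfl⟩⟩

lemma sel_meas {m : MeasurableSpace Ω} {A B A' B' : Ω → ℝ} (hA : Measurable[m] A)
    (hB : Measurable[m] B) (hA' : Measurable[m] A') (hB' : Measurable[m] B') :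
    Measurable[m] (fun ω => sel (A ω) (B ω) (A' ω) (B' ω)) := by
  unfold sel
  have z : Measurable[m] (fun _ : Ω => (0:ℝ)) := measurable_const
  refine Measurable.ite ((measurableSet_le z hA).inter (measurableSet_le z hA'))
    measurable_const ?_
  refine Measurable.ite ((measurableSet_le hB z).inter (measurableSet_le hB' z))
    measurable_const ?_
  refine Measurable.ite ((measurableSet_le z hB).inter (measurableSet_le hA' z))
    measurable_const ?_
  refine Measurable.ite ((measurableSet_le hA z).inter (measurableSet_le z hB'))
    measurable_const ?_
  exact (hB'.div (hB'.sub hA')).prodMk (hB.div (hB.sub hA))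


/-- stage payoff of stopping -/
noncomputable def AA (U : ℕ → ℕ → Ω → ℝ) (τ1 : ℕ → Ω → ℕ) (q : Ω → ℝ) (t : ℕ) (ω : Ω) : ℝ :=
  q ω * U t t ω + (1 - q ω) * (μ[fun ω => U t (τ1 t ω) ω | 𝓕 t]) ω

/-- stage payoff of continuing -/
noncomputable def BB (U : ℕ → ℕ → Ω → ℝ) (ρ1 : ℕ → Ω → ℕ) (q : Ω → ℝ) (W : Ω → ℝ) (t : ℕ)
    (ω : Ω) : ℝ :=
  q ω * (μ[fun ω => U (ρ1 t ω) t ω | 𝓕 t]) ω + (1 - q ω) * (μ[W | 𝓕 t]) ω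

lemma int_U [IsProbabilityMeasure μ] (U : ℕ → ℕ → Ω → ℝ) (hU : ∀ s t, Measurable (U s t))
    (C : ℝ) (hb : ∀ s t ω, |U s t ω| ≤ C) {a b : Ω → ℕ} (ha : Measurable a) (hb' : Measurable b) :
    Integrable (fun ω => U (a ω) (b ω) ω) μ :=
  Integrable.of_bound (meas_comp U hU a b id ha hb' measurable_id).aestronglyMeasurable C
      (Filter.Eventually.of_forall fun ω => by simpa using hb _ _ _)

lemma integral_add4 {a1 a2 a3 a4 f1 f2 f3 f4 : Ω → ℝ} (h1 : Wt m0 a1) (h2 : Wt m0 a2)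
    (h3 : Wt m0 a3) (h4 : Wt m0 a4) (i1 : Integrable f1 μ) (i2 : Integrable f2 μ)
    (i3 : Integrable f3 μ) (i4 : Integrable f4 μ) :
    Integrable (fun ω => a1 ω * f1 ω + a2 ω * f2 ω + (a3 ω * f3 ω + a4 ω * f4 ω)) μ ∧
    ∫ ω, (a1 ω * f1 ω + a2 ω * f2 ω + (a3 ω * f3 ω + a4 ω * f4 ω)) ∂μ =
      ∫ ω, a1 ω * f1 ω ∂μ + ∫ ω, a2 ω * f2 ω ∂μ +
        (∫ ω, a3 ω * f3 ω ∂μ + ∫ ω, a4 ω * f4 ω ∂μ) := by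
  have j1 := h1.int μ i1
  have j2 := h2.int μ i2
  have j3 := h3.int μ i3
  have j4 := h4.int μ i4
  refine ⟨(j1.add j2).add (j3.add j4), ?_⟩
  rw [← integral_add j1 j2, ← integral_add j3 j4]
  exact integral_add (j1.add j2) (j3.add j4)

/-- increments of the payoff -/
noncomputable def DD (U : ℕ → ℕ → Ω → ℝ) (ζ : Ω → ℕ) (ρ1 τ1 : ℕ → Ω → ℕ) (q : ℕ → Ω → ℝ) (t : ℕ)
    (ω : Ω) : ℝ :=
  {ω | ζ ω = t}.indicator 1 ω * Rr q t ω * q t ω * U t t ω +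
  {ω | ζ ω = t}.indicator 1 ω * Rr q t ω * (1 - q t ω) * U t (τ1 t ω) ω +
  {ω | t < ζ ω}.indicator 1 ω * Rr q t ω * q t ω * U (ρ1 t ω) t ω

/-- remaining value -/
noncomputable def MM (ζ : Ω → ℕ) (V q : ℕ → Ω → ℝ) (t : ℕ) (ω : Ω) : ℝ :=
  {ω | t ≤ ζ ω}.indicator 1 ω * Rr q t ω * V t ω

lemma path_sum (U : ℕ → ℕ → Ω → ℝ) (ζ : Ω → ℕ) (ρ1 τ1 : ℕ → Ω → ℕ) (q : ℕ → Ω → ℝ)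
    (hqT : ∀ ω, q T ω = 1) (ω : Ω) (hζ : ζ ω ≤ T) :
    ∑ t ∈ Finset.range (T+1), Rr q t ω * q t ω *
      U (if ζ ω ≤ t then ζ ω else ρ1 t ω) (if t ≤ ζ ω then t else τ1 (ζ ω) ω) ω =
    ∑ t ∈ Finset.range (T+1), DD U ζ ρ1 τ1 q t ω := by
  obtain ⟨n, hn⟩ : ∃ n, ζ ω = n := ⟨_, rfl⟩
  have hnT : n < T + 1 := by omega
  simp only [Finset.range_eq_Ico]
  rw [← Finset.sum_Ico_consecutive _ (Nat.zero_le n) hnT.le,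
    ← Finset.sum_Ico_consecutive (fun t => DD U ζ ρ1 τ1 q t ω) (Nat.zero_le n) hnT.le,
    Finset.sum_eq_sum_Ico_succ_bot hnT,
    Finset.sum_eq_sum_Ico_succ_bot hnT (fun t => DD U ζ ρ1 τ1 q t ω)]
  congr 1
  · refine Finset.sum_congr rfl fun t ht => ?_
    simp only [Finset.mem_Ico] at ht
    have h1 : t < n := ht.2
    simp [DD, hn, h1, h1.le, h1.ne', not_le.2 h1]
  · have e1 : ∑ t ∈ Finset.Ico (n+1) (T+1), DD U ζ ρ1 τ1 q t ω = 0 := by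
      refine Finset.sum_eq_zero fun t ht => ?_
      simp only [Finset.mem_Ico] at ht
      have h1 : n < t := ht.1
      simp [DD, hn, h1.ne, not_lt.2 h1.le]
    have e2 : ∑ t ∈ Finset.Ico (n+1) (T+1), Rr q t ω * q t ω *
      U (if ζ ω ≤ t then ζ ω else ρ1 t ω) (if t ≤ ζ ω then t else τ1 (ζ ω) ω) ω =
      ∑ t ∈ Finset.Ico (n+1) (T+1), (Rr q t ω - Rr q (t+1) ω) * U n (τ1 n ω) ω := by
      refine Finset.sum_congr rfl fun t ht => ?_
      simp only [Finset.mem_Ico] at ht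
      have h1 : n < t := ht.1
      simp only [hn, h1.le, not_le.2 h1, if_true, if_false, Rr_succ]
      ring
    have e3 : ∑ t ∈ Finset.Ico (n+1) (T+1), (Rr q t ω - Rr q (t+1) ω) = Rr q (n+1) ω := by
      have := Finset.sum_Ico_sub (fun t => Rr q t ω) (show n+1 ≤ T+1 by omega)
      have h0 : Rr q (T+1) ω = 0 := by rw [Rr_succ, hqT]; simp
      rw [h0] at this
      rw [← neg_inj, ← Finset.sum_neg_distrib]
      simpa using this
    rw [e1, e2, ← Finset.sum_mul, e3, Rr_succ]
    simp [DD, hn]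

section verif

variable {ζ : Ω → ℕ} {ρ1 ρ1' τ1 : ℕ → Ω → ℕ} {V q : ℕ → Ω → ℝ}

lemma DD_int [IsProbabilityMeasure μ] (U : ℕ → ℕ → Ω → ℝ)
    (hU : ∀ s t, Measurable (U s t)) (C : ℝ) (hb : ∀ s t ω, |U s t ω| ≤ C)
    (hζ : MemT 𝓕 T ζ) (hρ' : MemTTa 𝓕 T ρ1') (hτ : MemTTa 𝓕 T τ1)
    (hq : ∀ t ≤ T, Wt (𝓕 t) (q t)) {t : ℕ} (ht : t ≤ T) :
    Integrable (DD U ζ ρ1' τ1 q t) μ := by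
  have m1 := 𝓕.le t
  have hR := Rr_Wt 𝓕 T hq t t (by omega) ht
  have w1 := ((Wt.ind (hζ.eqS 𝓕 T t)).mul hR).mul (hq t ht)
  have w2 := ((Wt.ind (hζ.eqS 𝓕 T t)).mul hR).mul (hq t ht).compl
  have w3 := ((Wt.ind (hζ.gtS 𝓕 T t)).mul hR).mul (hq t ht)
  have i1 : Integrable (U t t) μ := int_U μ U hU C hb (a := fun _ => t) (b := fun _ => t)
    measurable_const measurable_const
  have i2 : Integrable (fun ω => U t (τ1 t ω) ω) μ := int_U μ U hU C hb (a := fun _ => t)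
    measurable_const ((hτ t ht).1.meas 𝓕 T)
  have i3 : Integrable (fun ω => U (ρ1' t ω) t ω) μ := int_U μ U hU C hb (b := fun _ => t)
    ((hρ' t ht).1.meas 𝓕 T) measurable_const
  exact (((w1.mono m1).int μ i1).add ((w2.mono m1).int μ i2)).add ((w3.mono m1).int μ i3)

lemma MM_int (hζ : MemT 𝓕 T ζ) (hq : ∀ t ≤ T, Wt (𝓕 t) (q t)) {t : ℕ} (ht : t ≤ T)
    (hVi : Integrable (V t) μ) : Integrable (MM ζ V q t) μ := by
  have m1 := 𝓕.le t
  have hR := Rr_Wt 𝓕 T hq t t (by omega) ht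
  exact (((Wt.ind (hζ.geS 𝓕 T t)).mul hR).mono m1).int μ hVi

lemma step [IsProbabilityMeasure μ] (U : ℕ → ℕ → Ω → ℝ)
    (hU : ∀ s t, Measurable (U s t)) (C : ℝ) (hb : ∀ s t ω, |U s t ω| ≤ C)
    (hζ : MemT 𝓕 T ζ) (hρ : MemTTa 𝓕 T ρ1) (hρ' : MemTTa 𝓕 T ρ1') (hτ : MemTTa 𝓕 T τ1)
    (hq : ∀ t ≤ T, Wt (𝓕 t) (q t)) {t : ℕ} (ht : t < T)
    (hVi : ∀ t ≤ T, Integrable (V t) μ)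
    (hopt : ∀ σ, MemTgePlus 𝓕 T t σ → ∀ f, Wt (𝓕 t) f →
      ∫ ω, f ω * U (σ ω) t ω ∂μ ≤ ∫ ω, f ω * U (ρ1 t ω) t ω ∂μ)
    (hV : ∀ ω, V t ω = max (AA μ 𝓕 U τ1 (q t) t ω) (BB μ 𝓕 U ρ1 (q t) (V (t+1)) t ω)) :
    ∫ ω, DD U ζ ρ1' τ1 q t ω ∂μ + ∫ ω, MM ζ V q (t+1) ω ∂μ ≤ ∫ ω, MM ζ V q t ω ∂μ ∧
    ((∀ ω, ζ ω = t → BB μ 𝓕 U ρ1 (q t) (V (t+1)) t ω ≤ AA μ 𝓕 U τ1 (q t) t ω) →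
     (∀ ω, t < ζ ω → AA μ 𝓕 U τ1 (q t) t ω ≤ BB μ 𝓕 U ρ1 (q t) (V (t+1)) t ω) →
     ρ1' = ρ1 →
     ∫ ω, DD U ζ ρ1' τ1 q t ω ∂μ + ∫ ω, MM ζ V q (t+1) ω ∂μ = ∫ ω, MM ζ V q t ω ∂μ) := by
  have m1 := 𝓕.le t
  have hR := Rr_Wt 𝓕 T hq t t (by omega) ht.le
  have w1 := ((Wt.ind (hζ.eqS 𝓕 T t)).mul hR).mul (hq t ht.le)
  have w2 := ((Wt.ind (hζ.eqS 𝓕 T t)).mul hR).mul (hq t ht.le).compl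
  have w3 := ((Wt.ind (hζ.gtS 𝓕 T t)).mul hR).mul (hq t ht.le)
  have w4 := ((Wt.ind (hζ.gtS 𝓕 T t)).mul hR).mul (hq t ht.le).compl
  have i1 : Integrable (U t t) μ := int_U μ U hU C hb (a := fun _ => t) (b := fun _ => t)
    measurable_const measurable_const
  have i2 : Integrable (fun ω => U t (τ1 t ω) ω) μ := int_U μ U hU C hb (a := fun _ => t)
    measurable_const ((hτ t ht.le).1.meas 𝓕 T)
  have i3 : Integrable (fun ω => U (ρ1 t ω) t ω) μ := int_U μ U hU C hb (b := fun _ => t)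
    ((hρ t ht.le).1.meas 𝓕 T) measurable_const
  have i3' : Integrable (fun ω => U (ρ1' t ω) t ω) μ := int_U μ U hU C hb (b := fun _ => t)
    ((hρ' t ht.le).1.meas 𝓕 T) measurable_const
  have i4 := hVi (t+1) ht
  have E1 : ∫ ω, DD U ζ ρ1' τ1 q t ω ∂μ + ∫ ω, MM ζ V q (t+1) ω ∂μ =
      ∫ ω, ({ω | ζ ω = t}.indicator 1 ω * Rr q t ω * q t ω * U t t ω +
        {ω | ζ ω = t}.indicator 1 ω * Rr q t ω * (1 - q t ω) * U t (τ1 t ω) ω +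
        ({ω | t < ζ ω}.indicator 1 ω * Rr q t ω * q t ω * U (ρ1' t ω) t ω +
        {ω | t < ζ ω}.indicator 1 ω * Rr q t ω * (1 - q t ω) * V (t+1) ω)) ∂μ := by
    rw [← integral_add (DD_int μ 𝓕 T U hU C hb hζ hρ' hτ hq ht.le) (MM_int μ 𝓕 T hζ hq ht i4)]
    congr 1; ext ω
    simp only [DD, MM, Rr_succ, Nat.succ_le_iff]
    ring
  have E2 := (integral_add4 μ (w1.mono m1) (w2.mono m1) (w3.mono m1) (w4.mono m1) i1 i2 i3' i4).2
  have F2 := integral_add4 μ (w1.mono m1) (w2.mono m1) (w3.mono m1) (w4.mono m1) i1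
    (integrable_condExp (m := 𝓕 t) (f := fun ω => U t (τ1 t ω) ω))
    (integrable_condExp (m := 𝓕 t) (f := fun ω => U (ρ1 t ω) t ω))
    (integrable_condExp (m := 𝓕 t) (f := V (t+1)))
  have E3 := F2.2
  rw [← int_condExp μ m1 w2 i2, ← int_condExp μ m1 w3 i3, ← int_condExp μ m1 w4 i4] at E3
  have pw : ∀ ω, {ω | ζ ω = t}.indicator 1 ω * Rr q t ω * q t ω * U t t ω +
        {ω | ζ ω = t}.indicator 1 ω * Rr q t ω * (1 - q t ω) *
          (μ[fun ω => U t (τ1 t ω) ω | 𝓕 t]) ω +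
        ({ω | t < ζ ω}.indicator 1 ω * Rr q t ω * q t ω * (μ[fun ω => U (ρ1 t ω) t ω | 𝓕 t]) ω +
        {ω | t < ζ ω}.indicator 1 ω * Rr q t ω * (1 - q t ω) * (μ[V (t+1) | 𝓕 t]) ω)
      = {ω | ζ ω = t}.indicator 1 ω * Rr q t ω * AA μ 𝓕 U τ1 (q t) t ω +
        {ω | t < ζ ω}.indicator 1 ω * Rr q t ω * BB μ 𝓕 U ρ1 (q t) (V (t+1)) t ω := by
    intro ω; unfold AA BB; ring
  have hMi := MM_int μ 𝓕 T hζ hq ht.le (hVi t ht.le)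
  constructor
  · have o := hopt _ (hρ' t ht.le) _ w3
    refine le_trans (b := _) ?_ (integral_mono F2.1 hMi ?_)
    · rw [E1, E2, E3]; linarith
    · intro ω
      dsimp only
      rw [pw ω, MM, hV ω]
      have hR0 := (hR.2 ω).1
      rcases lt_trichotomy (ζ ω) t with h | h | h
      · simp [h.ne, not_lt.2 h.le, not_le.2 h]
      · simp only [h, mem_ofPred_eq, indicator_of_mem, lt_irrefl, le_refl, Pi.one_apply, one_mul,
          not_false_eq_true, indicator_of_notMem, zero_mul, add_zero]
        gcongr; exact le_max_left _ _
      · simp only [h, h.ne', h.le, mem_ofPred_eq, indicator_of_mem, Pi.one_apply, one_mul,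
          not_false_eq_true, indicator_of_notMem, zero_mul, zero_add]
        gcongr; exact le_max_right _ _
  · rintro hA hB rfl
    rw [E1, E2, ← E3]
    congr 1; ext ω
    rw [pw ω, MM, hV ω]
    rcases lt_trichotomy (ζ ω) t with h | h | h
    · simp [h.ne, not_lt.2 h.le, not_le.2 h]
    · rw [max_eq_left (hA ω h)]; simp [h]
    · rw [max_eq_right (hB ω h)]; simp [h, h.ne', h.le]

lemma verif [IsProbabilityMeasure μ] (U : ℕ → ℕ → Ω → ℝ)
    (hU : ∀ s t, Measurable (U s t)) (C : ℝ) (hb : ∀ s t ω, |U s t ω| ≤ C)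
    (hζ : MemT 𝓕 T ζ) (hρ : MemTTa 𝓕 T ρ1) (hρ' : MemTTa 𝓕 T ρ1') (hτ : MemTTa 𝓕 T τ1)
    (hq : ∀ t ≤ T, Wt (𝓕 t) (q t)) (hqT : ∀ ω, q T ω = 1)
    (hVi : ∀ t ≤ T, Integrable (V t) μ) (hVT : V T = U T T)
    (hopt : ∀ t < T, ∀ σ, MemTgePlus 𝓕 T t σ → ∀ f, Wt (𝓕 t) f →
      ∫ ω, f ω * U (σ ω) t ω ∂μ ≤ ∫ ω, f ω * U (ρ1 t ω) t ω ∂μ)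
    (hV : ∀ t < T, ∀ ω, V t ω =
      max (AA μ 𝓕 U τ1 (q t) t ω) (BB μ 𝓕 U ρ1 (q t) (V (t+1)) t ω)) :
    ∫ s in Icc (0:ℝ) 1, Gam μ U ζ ρ1' (rst T q s) τ1 ≤ ∫ ω, V 0 ω ∂μ ∧
    ((∀ t < T, ∀ ω, ζ ω = t → BB μ 𝓕 U ρ1 (q t) (V (t+1)) t ω ≤ AA μ 𝓕 U τ1 (q t) t ω) →
     (∀ t < T, ∀ ω, t < ζ ω → AA μ 𝓕 U τ1 (q t) t ω ≤ BB μ 𝓕 U ρ1 (q t) (V (t+1)) t ω) →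
     ρ1' = ρ1 →
     ∫ s in Icc (0:ℝ) 1, Gam μ U ζ ρ1' (rst T q s) τ1 = ∫ ω, V 0 ω ∂μ) := by
  have hG : ∫ s in Icc (0:ℝ) 1, Gam μ U ζ ρ1' (rst T q s) τ1 =
      ∑ t ∈ Finset.range (T+1), ∫ ω, DD U ζ ρ1' τ1 q t ω ∂μ := by
    rw [Gam_fubini μ 𝓕 T U hU C hb hζ hρ' (rst_MemTr 𝓕 T hq) hτ, ← integral_finsetSum]
    · congr 1; ext ω
      rw [← path_sum T U ζ ρ1' τ1 q hqT ω (hζ.2 ω)]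
      exact rst_int 𝓕 T hq hqT ω (fun t => U (if ζ ω ≤ t then ζ ω else ρ1' t ω)
        (if t ≤ ζ ω then t else τ1 (ζ ω) ω) ω)
    · intro t ht
      exact DD_int μ 𝓕 T U hU C hb hζ hρ' hτ hq (by simp at ht; omega)
  have h0 : MM ζ V q 0 = V 0 := by ext ω; simp [MM, Rr]
  have hT : DD U ζ ρ1' τ1 q T = MM ζ V q T := by
    ext ω
    have := hζ.2 ω
    rcases this.eq_or_lt with h | h
    · simp [DD, MM, hqT, hVT, h]
    · simp [DD, MM, hqT, h.ne, not_lt.2 h.le, h]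
  have st := fun t (ht : t < T) => step μ 𝓕 T U hU C hb hζ hρ hρ' hτ hq ht hVi (hopt t ht) (hV t ht)
  rw [hG, Finset.sum_range_succ, hT, ← h0]
  constructor
  · have : ∀ n ≤ T, ∑ t ∈ Finset.range n, ∫ ω, DD U ζ ρ1' τ1 q t ω ∂μ +
        ∫ ω, MM ζ V q n ω ∂μ ≤ ∫ ω, MM ζ V q 0 ω ∂μ := by
      intro n hn
      induction n with
      | zero => simp
      | succ n ih =>
        have a := ih (by omega)
        have b := (st n (by omega)).1
        rw [Finset.sum_range_succ]; linarith
    exact this T le_rfl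
  · intro hA hB he
    have : ∀ n ≤ T, ∑ t ∈ Finset.range n, ∫ ω, DD U ζ ρ1' τ1 q t ω ∂μ +
        ∫ ω, MM ζ V q n ω ∂μ = ∫ ω, MM ζ V q 0 ω ∂μ := by
      intro n hn
      induction n with
      | zero => simp
      | succ n ih =>
        have a := ih (by omega)
        have b := (st n (by omega)).2 (hA n hn) (hB n hn) he
        rw [Finset.sum_range_succ]; linarith
    exact this T le_rfl

lemma one_player [IsProbabilityMeasure μ] (U : ℕ → ℕ → Ω → ℝ)
    (hU : ∀ s t, Measurable (U s t)) (C : ℝ) (hb : ∀ s t ω, |U s t ω| ≤ C)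
    {p : ℕ → Ω → ℝ} (hρ : MemTTa 𝓕 T ρ1) (hτ : MemTTa 𝓕 T τ1)
    (hp : ∀ t ≤ T, Wt (𝓕 t) (p t)) (hpT : ∀ ω, p T ω = 1)
    (hq : ∀ t ≤ T, Wt (𝓕 t) (q t)) (hqT : ∀ ω, q T ω = 1)
    (hVi : ∀ t ≤ T, Integrable (V t) μ) (hVT : V T = U T T)
    (hopt : ∀ t < T, ∀ σ, MemTgePlus 𝓕 T t σ → ∀ f, Wt (𝓕 t) f →
      ∫ ω, f ω * U (σ ω) t ω ∂μ ≤ ∫ ω, f ω * U (ρ1 t ω) t ω ∂μ)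
    (hV : ∀ t < T, ∀ ω, V t ω =
      max (AA μ 𝓕 U τ1 (q t) t ω) (BB μ 𝓕 U ρ1 (q t) (V (t+1)) t ω))
    (hBR : ∀ t < T, ∀ ω,
      BR (AA μ 𝓕 U τ1 (q t) t ω - BB μ 𝓕 U ρ1 (q t) (V (t+1)) t ω) (p t ω))
    (α' : ℝ → Ω → ℕ) (hα' : MemTr 𝓕 T α') (hρ' : MemTTa 𝓕 T ρ1') :
    uPay μ U α' ρ1' (rst T q) τ1 ≤ uPay μ U (rst T p) ρ1 (rst T q) τ1 := by
  have hr := rst_MemTr 𝓕 T hp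
  have e : uPay μ U (rst T p) ρ1 (rst T q) τ1 = ∫ _ in Ioc (0:ℝ) 1, ∫ ω, V 0 ω ∂μ := by
    unfold uPay
    rw [integral_Icc_eq_integral_Ioc]
    refine setIntegral_congr_fun measurableSet_Ioc fun s hs => ?_
    refine (verif μ 𝓕 T U hU C hb (hr.2 s) hρ hρ hτ hq hqT hVi hVT hopt hV).2 ?_ ?_ rfl
    · intro t ht ω h
      have := (hBR t ht ω).2.2.1 ((rst_supp 𝓕 T hp hpT hs ω ht).1 h)
      linarith
    · intro t ht ω h
      have := (hBR t ht ω).2.2.2 ((rst_supp 𝓕 T hp hpT hs ω ht).2 h)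
      linarith
  rw [e, ← integral_Icc_eq_integral_Ioc]
  unfold uPay
  refine integral_mono ?_ (integrable_const _) ?_
  · exact (int_Gam μ 𝓕 T U hU C hb hα' hρ' (rst_MemTr 𝓕 T hq) hτ).integral_prod_left
  · intro s
    exact (verif μ 𝓕 T U hU C hb (hα'.2 s) hρ hρ' hτ hq hqT hVi hVT hopt hV).1

end verif

lemma back_rec {A : Type*} (P : ℕ → A → Prop) (Q : ℕ → A → A → Prop) (x : A) (h0 : P T x)
    (hs : ∀ t < T, ∀ y, P (t+1) y → ∃ x, P t x ∧ Q t x y) :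
    ∃ V : ℕ → A, V T = x ∧ (∀ t ≤ T, P t (V t)) ∧ ∀ t < T, Q t (V t) (V (t+1)) := by
  have : ∀ n ≤ T, ∃ V : ℕ → A, V T = x ∧ (∀ t ≤ T, n ≤ t → P t (V t)) ∧
      ∀ t < T, n ≤ t → Q t (V t) (V (t+1)) := by
    intro n hn
    induction hn using Nat.decreasingInduction with
    | self =>
      refine ⟨fun _ => x, rfl, fun t h1 h2 => ?_, fun t h1 h2 => by omega⟩
      obtain rfl : t = T := le_antisymm h1 h2
      exact h0
    | of_succ n hn ih =>
      obtain ⟨V, hV, h1, h2⟩ := ih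
      obtain ⟨y, hy1, hy2⟩ := hs n hn _ (h1 (n+1) hn le_rfl)
      refine ⟨Function.update V n y, ?_, ?_, ?_⟩
      · rw [Function.update_of_ne (by omega)]; exact hV
      · intro t ht hnt
        rcases hnt.eq_or_lt with rfl | h
        · simpa using hy1
        · rw [Function.update_of_ne (by omega)]; exact h1 t ht h
      · intro t ht hnt
        rw [Function.update_of_ne (by omega : t + 1 ≠ n)]
        rcases hnt.eq_or_lt with rfl | h
        · simpa using hy2
        · rw [Function.update_of_ne (by omega)]; exact h2 t ht h
  obtain ⟨V, h1, h2, h3⟩ := this 0 (Nat.zero_le _)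
  exact ⟨V, h1, fun t ht => h2 t ht (Nat.zero_le _), fun t ht => h3 t ht (Nat.zero_le _)⟩

lemma exists_adj [IsProbabilityMeasure μ] (U : ℕ → ℕ → Ω → ℝ)
    (hU : ∀ s t, Measurable[𝓕 (max s t)] (U s t)) (C : ℝ) (hb : ∀ s t ω, |U s t ω| ≤ C) :
    ∃ ρ1, MemTTa 𝓕 T ρ1 ∧ ∀ t < T, ∀ σ, MemTgePlus 𝓕 T t σ → ∀ f, Wt (𝓕 t) f →
      ∫ ω, f ω * U (σ ω) t ω ∂μ ≤ ∫ ω, f ω * U (ρ1 t ω) t ω ∂μ := by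
  have : ∀ t, ∃ σ, t ≤ T → (MemTgePlus 𝓕 T t σ ∧ (t < T → ∀ σ', MemTgePlus 𝓕 T t σ' →
      ∀ f, Wt (𝓕 t) f →
      ∫ ω, f ω * U (σ' ω) t ω ∂μ ≤ ∫ ω, f ω * U (σ ω) t ω ∂μ)) := by
    intro t
    by_cases ht : t ≤ T
    · obtain ⟨σ, h1, h2, h3⟩ := snell_exists μ 𝓕 T (fun s => U s t) C (fun s ω => hb s t ω)
        (min (t+1) T) (min_le_right _ _) (fun s hs => by
          have := hU s t
          rwa [max_eq_left (by omega)] at this)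
      refine ⟨σ, fun _ => ⟨⟨h1, h2⟩, fun hlt σ' hσ' f hf => ?_⟩⟩
      exact h3 σ' hσ'.1 hσ'.2 f (hf.mono (𝓕.mono (by omega)))
    · exact ⟨fun _ => 0, fun h => absurd h ht⟩
  choose ρ1 h using this
  exact ⟨ρ1, fun t ht => (h t ht).1, fun t ht => (h t ht.le).2 ht⟩

lemma AABB_int [IsProbabilityMeasure μ] (U : ℕ → ℕ → Ω → ℝ) (hU : ∀ s t, Measurable (U s t))
    (C : ℝ) (hb : ∀ s t ω, |U s t ω| ≤ C) (ρ1 τ1 : ℕ → Ω → ℕ) {q : Ω → ℝ} {t : ℕ}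
    (hq : Wt (𝓕 t) q) (W : Ω → ℝ) :
    Integrable (fun ω => max (AA μ 𝓕 U τ1 q t ω) (BB μ 𝓕 U ρ1 q W t ω)) μ := by
  have i1 : Integrable (U t t) μ := int_U μ U hU C hb (a := fun _ => t) (b := fun _ => t)
    measurable_const measurable_const
  have m1 := 𝓕.le t
  exact (((hq.mono m1).int μ i1).add ((hq.compl.mono m1).int μ integrable_condExp)).sup
    (((hq.mono m1).int μ integrable_condExp).add ((hq.compl.mono m1).int μ integrable_condExp))

/-- There exists a Nash equilibrium in mixed stopping strategies of type A for the
simultaneous-move non-zero-sum stopping game. -/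
theorem exists_nash_equilibrium_mixed
    [MeasurableSpace.CountablyGenerated Ω] [IsProbabilityMeasure μ]
    (U1 U2 : ℕ → ℕ → Ω → ℝ)
    (hU1m : ∀ s t, Measurable[𝓕 (max s t)] (U1 s t))
    (hU2m : ∀ s t, Measurable[𝓕 (max s t)] (U2 s t))
    (hU1b : ∃ C, ∀ s t ω, |U1 s t ω| ≤ C)
    (hU2b : ∃ C, ∀ s t ω, |U2 s t ω| ≤ C) :
    ∃ (α : ℝ → Ω → ℕ) (ρ1 : ℕ → Ω → ℕ) (β : ℝ → Ω → ℕ) (τ1 : ℕ → Ω → ℕ),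
      MemTr 𝓕 T α ∧ MemTTa 𝓕 T ρ1 ∧ MemTr 𝓕 T β ∧ MemTTa 𝓕 T τ1 ∧
      (∀ (α' : ℝ → Ω → ℕ) (ρ1' : ℕ → Ω → ℕ), MemTr 𝓕 T α' → MemTTa 𝓕 T ρ1' →
        uPay μ U1 α' ρ1' β τ1 ≤ uPay μ U1 α ρ1 β τ1) ∧
      (∀ (β' : ℝ → Ω → ℕ) (τ1' : ℕ → Ω → ℕ), MemTr 𝓕 T β' → MemTTa 𝓕 T τ1' →
        uPay μ U2 α ρ1 β' τ1' ≤ uPay μ U2 α ρ1 β τ1) := by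
  obtain ⟨C1, hb1⟩ := hU1b
  obtain ⟨C2, hb2'⟩ := hU2b
  have hb2 : ∀ s t ω, |(fun s t => U2 t s) s t ω| ≤ C2 := fun s t ω => hb2' t s ω
  have hm2 : ∀ s t, Measurable[𝓕 (max s t)] ((fun s t => U2 t s) s t) := fun s t => by
    rw [max_comm]; exact hU2m t s
  have hM1 : ∀ s t, Measurable (U1 s t) := fun s t => (hU1m s t).mono (𝓕.le _) le_rfl
  have hM2' : ∀ s t, Measurable (U2 s t) := fun s t => (hU2m s t).mono (𝓕.le _) le_rfl
  have hM2 : ∀ s t, Measurable ((fun s t => U2 t s) s t) := fun s t => hM2' t s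
  obtain ⟨ρ1, hρ, hopt1⟩ := exists_adj μ 𝓕 T U1 hU1m C1 hb1
  obtain ⟨τ1, hτ, hopt2⟩ := exists_adj μ 𝓕 T (fun s t => U2 t s) hm2 C2 hb2
  have one : ∀ t, Wt (𝓕 t) (fun _ => (1:ℝ)) := fun t => ⟨measurable_const, fun _ => by simp⟩
  obtain ⟨S, hST, hS1, hS2⟩ := back_rec T
    (fun t (x : (Ω → ℝ) × (Ω → ℝ) × (Ω → ℝ) × (Ω → ℝ)) =>
      Integrable x.1 μ ∧ Integrable x.2.1 μ ∧ Wt (𝓕 t) x.2.2.1 ∧ Wt (𝓕 t) x.2.2.2)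
    (fun t x y =>
      (∀ ω, x.1 ω = max (AA μ 𝓕 U1 τ1 x.2.2.2 t ω) (BB μ 𝓕 U1 ρ1 x.2.2.2 y.1 t ω)) ∧
      (∀ ω, x.2.1 ω = max (AA μ 𝓕 (fun s t => U2 t s) ρ1 x.2.2.1 t ω)
        (BB μ 𝓕 (fun s t => U2 t s) τ1 x.2.2.1 y.2.1 t ω)) ∧
      (∀ ω, BR (AA μ 𝓕 U1 τ1 x.2.2.2 t ω - BB μ 𝓕 U1 ρ1 x.2.2.2 y.1 t ω) (x.2.2.1 ω)) ∧
      (∀ ω, BR (AA μ 𝓕 (fun s t => U2 t s) ρ1 x.2.2.1 t ω -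
        BB μ 𝓕 (fun s t => U2 t s) τ1 x.2.2.1 y.2.1 t ω) (x.2.2.2 ω)))
    (U1 T T, U2 T T, fun _ => 1, fun _ => 1)
    ⟨int_U μ U1 hM1 C1 hb1 (a := fun _ => T) (b := fun _ => T) measurable_const measurable_const,
      int_U μ U2 hM2' C2 hb2' (a := fun _ => T) (b := fun _ => T) measurable_const
        measurable_const, one T, one T⟩
    (by
      rintro t ht ⟨W1, W2, -, -⟩ -
      have c1 : ∀ g : Ω → ℝ, Measurable[𝓕 t] (μ[g | 𝓕 t]) :=
        fun g => stronglyMeasurable_condExp.measurable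
      have u1 : Measurable[𝓕 t] (U1 t t) := by have := hU1m t t; rwa [max_self] at this
      have u2 : Measurable[𝓕 t] (U2 t t) := by have := hU2m t t; rwa [max_self] at this
      have hsel := sel_meas (u1.sub (c1 (fun ω => U1 (ρ1 t ω) t ω)))
        ((c1 (fun ω => U1 t (τ1 t ω) ω)).sub (c1 W1))
        (u2.sub (c1 (fun ω => (fun s t => U2 t s) (τ1 t ω) t ω)))
        ((c1 (fun ω => (fun s t => U2 t s) t (ρ1 t ω) ω)).sub (c1 W2))
      have hspec := fun ω => sel_spec ((U1 t t - μ[fun ω => U1 (ρ1 t ω) t ω | 𝓕 t]) ω)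
        ((μ[fun ω => U1 t (τ1 t ω) ω | 𝓕 t] - μ[W1 | 𝓕 t]) ω)
        ((U2 t t - μ[fun ω => (fun s t => U2 t s) (τ1 t ω) t ω | 𝓕 t]) ω)
        ((μ[fun ω => (fun s t => U2 t s) t (ρ1 t ω) ω | 𝓕 t] - μ[W2 | 𝓕 t]) ω)
      generalize hs : (fun ω => sel ((U1 t t - μ[fun ω => U1 (ρ1 t ω) t ω | 𝓕 t]) ω)
        ((μ[fun ω => U1 t (τ1 t ω) ω | 𝓕 t] - μ[W1 | 𝓕 t]) ω)
        ((U2 t t - μ[fun ω => (fun s t => U2 t s) (τ1 t ω) t ω | 𝓕 t]) ω)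
        ((μ[fun ω => (fun s t => U2 t s) t (ρ1 t ω) ω | 𝓕 t] - μ[W2 | 𝓕 t]) ω)) = f at hsel
      have hs' := fun ω => congrFun hs ω
      dsimp only at hs'
      simp only [hs'] at hspec
      have wp : Wt (𝓕 t) (fun ω => (f ω).1) :=
        ⟨measurable_fst.comp hsel, fun ω => ⟨(hspec ω).1.1, (hspec ω).1.2.1⟩⟩
      have wq : Wt (𝓕 t) (fun ω => (f ω).2) :=
        ⟨measurable_snd.comp hsel, fun ω => ⟨(hspec ω).2.1, (hspec ω).2.2.1⟩⟩
      refine ⟨(fun ω => max (AA μ 𝓕 U1 τ1 (fun ω => (f ω).2) t ω)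
          (BB μ 𝓕 U1 ρ1 (fun ω => (f ω).2) W1 t ω),
        fun ω => max (AA μ 𝓕 (fun s t => U2 t s) ρ1 (fun ω => (f ω).1) t ω)
          (BB μ 𝓕 (fun s t => U2 t s) τ1 (fun ω => (f ω).1) W2 t ω),
        fun ω => (f ω).1, fun ω => (f ω).2), ⟨?_, ?_, wp, wq⟩, fun ω => rfl, fun ω => rfl, ?_, ?_⟩
      · exact AABB_int μ 𝓕 U1 hM1 C1 hb1 ρ1 τ1 wq W1
      · exact AABB_int μ 𝓕 (fun s t => U2 t s) hM2 C2 hb2 τ1 ρ1 wp W2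
      · intro ω
        convert (hspec ω).1 using 1
        simp only [AA, BB, Pi.sub_apply]; ring
      · intro ω
        convert (hspec ω).2 using 1
        simp only [AA, BB, Pi.sub_apply]; ring)
  have hp : ∀ t ≤ T, Wt (𝓕 t) ((S t).2.2.1) := fun t ht => (hS1 t ht).2.2.1
  have hq : ∀ t ≤ T, Wt (𝓕 t) ((S t).2.2.2) := fun t ht => (hS1 t ht).2.2.2
  have hα := rst_MemTr 𝓕 T (q := fun t => (S t).2.2.1) hp
  have hβ := rst_MemTr 𝓕 T (q := fun t => (S t).2.2.2) hq
  refine ⟨rst T (fun t => (S t).2.2.1), ρ1, rst T (fun t => (S t).2.2.2), τ1, hα, hρ, hβ, hτ,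
    ?_, ?_⟩
  · intro α' ρ1' hα' hρ'
    exact one_player μ 𝓕 T U1 hM1 C1 hb1 (V := fun t => (S t).1) (p := fun t => (S t).2.2.1)
      (q := fun t => (S t).2.2.2) hρ hτ hp (by simp [hST]) hq (by simp [hST])
      (fun t ht => (hS1 t ht).1) (by simp [hST]) hopt1 (fun t ht => (hS2 t ht).1)
      (fun t ht => (hS2 t ht).2.2.1) α' hα' hρ'
  · intro β' τ1' hβ' hτ'
    rw [uPay_swap μ 𝓕 T U2 hM2' C2 hb2' hα hρ hβ hτ,
      uPay_swap μ 𝓕 T U2 hM2' C2 hb2' hα hρ hβ' hτ']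
    exact one_player μ 𝓕 T (fun s t => U2 t s) hM2 C2 hb2 (V := fun t => (S t).2.1)
      (p := fun t => (S t).2.2.2)
      (q := fun t => (S t).2.2.1) hτ hρ hq (by simp [hST]) hp (by simp [hST])
      (fun t ht => (hS1 t ht).2.1) (by simp [hST]) hopt2 (fun t ht => (hS2 t ht).2.1)
      (fun t ht => (hS2 t ht).2.2.2) β' hβ' hτ'

end
end

section
/- Suppose for each t ∈ {0,…,T} there are ρ*_1(t) ∈ 𝒯_{t+} and τ*_1(t) ∈ 𝒯_{t+} such that E_t[U^1(σ, t)] ≤ E_t[U^1(ρ*_1(t), t)] a.s. and E_t[U^2(t, σ)] ≤ E_t[U^2(t, τ*_1(t))] a.s. for every σ ∈ 𝒯_{t+} (so ρ*_1, τ*_1 ∈ 𝕋^a). Define the adapted processes X^1_t := E_t[U^1(t, τ*_1(t))], Y^1_t := E_t[U^1(ρ*_1(t), t)], X^2_t := E_t[U^2(t, τ*_1(t))], Y^2_t := E_t[U^2(ρ*_1(t), t)], Z^i_t := U^i(t,t). If (α*, β*) ∈ 𝒯^r × 𝒯^r is a Nash equilibrium for the randomized Dynkin game ũ^i, i.e.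 ũ^1(α, β*) ≤ ũ^1(α*, β*) and ũ^2(α*, β) ≤ ũ^2(α*, β*) for all α, β ∈ 𝒯^r, then (ρ*_m, τ*_m) := ((α*, ρ*_1), (β*, τ*_1)) is a Nash equilibrium in 𝔗^{ar} for the game u^i: u^1(ρ, τ*_m) ≤ u^1(ρ*_m, τ*_m) and u^2(ρ*_m, τ) ≤ u^2(ρ*_m, τ*_m) for all ρ, τ ∈ 𝔗^{ar}. -/
open MeasureTheory Set

section

variable {Ω : Type*} {m0 : MeasurableSpace Ω} (μ : Measure Ω) (𝓕 : Filtration ℕ m0) (T : ℕ)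

/-- `X_t = E_t[U(t, τ₁(t))]`. -/
noncomputable def Xproc (U : ℕ → ℕ → Ω → ℝ) (τ1 : ℕ → Ω → ℕ) (t : ℕ) : Ω → ℝ :=
  μ[fun ω => U t (τ1 t ω) ω | 𝓕 t]

/-- `Y_t = E_t[U(ρ₁(t), t)]`. -/
noncomputable def Yproc (U : ℕ → ℕ → Ω → ℝ) (ρ1 : ℕ → Ω → ℕ) (t : ℕ) : Ω → ℝ :=
  μ[fun ω => U (ρ1 t ω) t ω | 𝓕 t]

/-- `Z_t = U(t,t)`. -/
def Zproc (U : ℕ → ℕ → Ω → ℝ) (t : ℕ) : Ω → ℝ :=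
  fun ω => U t t ω

/-- The payoff `ũ(α,β)` of the auxiliary Dynkin game with randomized stopping
times `α, β` and payoff processes `X, Y, Z`. -/
noncomputable def utilde (X Y Z : ℕ → Ω → ℝ) (α β : ℝ → Ω → ℕ) : ℝ :=
  ∫ p in Icc (0:ℝ) 1, ∫ q in Icc (0:ℝ) 1, ∫ ω,
    ((if α p ω < β q ω then X (α p ω) ω else 0) +
     (if β q ω < α p ω then Y (β q ω) ω else 0) +
     (if α p ω = β q ω then Z (α p ω) ω else 0)) ∂μ

lemma measurableSet_A {a b : Ω → ℕ} (ha : MemT 𝓕 T a) (hb : MemT 𝓕 T b) (t : ℕ) :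
    MeasurableSet[𝓕 t] {ω | a ω = t ∧ t < b ω} := by
  have h1 := ha.1.measurableSet_eq t
  have h2 := hb.1.measurableSet_gt t
  have := h1.inter h2
  convert this using 1
  ext ω
  simp

lemma measurableSet_C {a b : Ω → ℕ} (ha : MemT 𝓕 T a) (hb : MemT 𝓕 T b) (t : ℕ) :
    MeasurableSet[𝓕 t] {ω | a ω = t ∧ b ω = t} := by
  have h1 := ha.1.measurableSet_eq t
  have h2 := hb.1.measurableSet_eq t
  have := h1.inter h2
  convert this using 1
  ext ω
  simp

lemma measurable_of_memT {a : Ω → ℕ} (ha : MemT 𝓕 T a) : Measurable a := by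
  refine measurable_to_countable' fun t => ?_
  have h1 := 𝓕.le t _ (ha.1.measurableSet_eq t)
  convert h1 using 1
  ext ω
  simp

lemma measurable_unc {U : ℕ → ℕ → Ω → ℝ} (hU : ∀ s t, Measurable[𝓕 (max s t)] (U s t)) :
    Measurable (fun x : (ℕ × ℕ) × Ω => U x.1.1 x.1.2 x.2) :=
  measurable_from_prod_countable_right fun st => (hU st.1 st.2).mono (𝓕.le _) le_rfl

lemma integrable_U [IsProbabilityMeasure μ] {U : ℕ → ℕ → Ω → ℝ}
    (hU : ∀ s t, Measurable[𝓕 (max s t)] (U s t)) (hb : ∃ C, ∀ s t ω, |U s t ω| ≤ C)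
    {a b : Ω → ℕ} (ha : Measurable a) (hb' : Measurable b) :
    Integrable (fun ω => U (a ω) (b ω) ω) μ := by
  obtain ⟨C, hC⟩ := hb
  refine Integrable.of_bound (C := C) ?_ (ae_of_all _ fun ω => by simpa using hC _ _ ω)
  exact ((measurable_unc 𝓕 hU).comp ((ha.prodMk hb').prodMk measurable_id)).aestronglyMeasurable

lemma dyn_sum {a b : Ω → ℕ} (ha : MemT 𝓕 T a) (hb : MemT 𝓕 T b) {f g h : ℕ → Ω → ℝ}
    (hf : ∀ t ≤ T, Integrable (f t) μ) (hg : ∀ t ≤ T, Integrable (g t) μ)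
    (hh : ∀ t ≤ T, Integrable (h t) μ) :
    ∫ ω, ((if a ω < b ω then f (a ω) ω else 0) +
     (if b ω < a ω then g (b ω) ω else 0) +
     (if a ω = b ω then h (a ω) ω else 0)) ∂μ =
    ∑ t ∈ Finset.range (T + 1), ((∫ ω in {ω | a ω = t ∧ t < b ω}, f t ω ∂μ) +
      (∫ ω in {ω | b ω = t ∧ t < a ω}, g t ω ∂μ) +
      (∫ ω in {ω | a ω = t ∧ b ω = t}, h t ω ∂μ)) := by
  have mA := fun t => 𝓕.le t _ (measurableSet_A 𝓕 T ha hb t)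
  have mB := fun t => 𝓕.le t _ (measurableSet_A 𝓕 T hb ha t)
  have mC := fun t => 𝓕.le t _ (measurableSet_C 𝓕 T ha hb t)
  have e : ∀ ω, ((if a ω < b ω then f (a ω) ω else 0) +
     (if b ω < a ω then g (b ω) ω else 0) +
     (if a ω = b ω then h (a ω) ω else 0)) =
     ∑ t ∈ Finset.range (T + 1), ({ω | a ω = t ∧ t < b ω}.indicator (f t) ω +
      {ω | b ω = t ∧ t < a ω}.indicator (g t) ω +
      {ω | a ω = t ∧ b ω = t}.indicator (h t) ω) := by
    intro ω
    have h1 := ha.2 ω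
    have h2 := hb.2 ω
    rw [Finset.sum_add_distrib, Finset.sum_add_distrib]
    congr 1
    · congr 1
      · rw [Finset.sum_eq_single (a ω)]
        · simp [Set.indicator_apply]
        · intro t _ ht
          simp [Set.indicator_apply, ht.symm]
        · intro hn
          exact absurd (Finset.mem_range.2 (by omega)) hn
      · rw [Finset.sum_eq_single (b ω)]
        · simp [Set.indicator_apply]
        · intro t _ ht
          simp [Set.indicator_apply, ht.symm]
        · intro hn
          exact absurd (Finset.mem_range.2 (by omega)) hn
    · rw [Finset.sum_eq_single (a ω)]
      · simp [Set.indicator_apply, eq_comm]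
      · intro t _ ht
        simp [Set.indicator_apply, ht.symm]
      · intro hn
        exact absurd (Finset.mem_range.2 (by omega)) hn
  simp_rw [e]
  rw [integral_finsetSum]
  · refine Finset.sum_congr rfl fun t ht => ?_
    have ht : t ≤ T := by simpa [Nat.lt_succ_iff] using ht
    have i1 := (hf t ht).indicator (mA t)
    have i2 := (hg t ht).indicator (mB t)
    have i3 := (hh t ht).indicator (mC t)
    rw [integral_add (by exact i1.add i2) i3, integral_add i1 i2,
      integral_indicator (mA t), integral_indicator (mB t), integral_indicator (mC t)]
  · intro t ht
    have ht : t ≤ T := by simpa [Nat.lt_succ_iff] using ht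
    exact (((hf t ht).indicator (mA t)).add ((hg t ht).indicator (mB t))).add
      ((hh t ht).indicator (mC t))

lemma gam_sum [IsProbabilityMeasure μ] {U : ℕ → ℕ → Ω → ℝ}
    (hU : ∀ s t, Measurable[𝓕 (max s t)] (U s t)) (hbd : ∃ C, ∀ s t ω, |U s t ω| ≤ C)
    {a b : Ω → ℕ} (ha : MemT 𝓕 T a) (hb : MemT 𝓕 T b) {ρ τ : ℕ → Ω → ℕ}
    (hρ : MemTTa 𝓕 T ρ) (hτ : MemTTa 𝓕 T τ) :
    Gam μ U a ρ b τ =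
    ∑ t ∈ Finset.range (T + 1), ((∫ ω in {ω | a ω = t ∧ t < b ω}, U t (τ t ω) ω ∂μ) +
      (∫ ω in {ω | b ω = t ∧ t < a ω}, U (ρ t ω) t ω ∂μ) +
      (∫ ω in {ω | a ω = t ∧ b ω = t}, U t t ω ∂μ)) := by
  rw [← dyn_sum μ 𝓕 T ha hb (f := fun t ω => U t (τ t ω) ω) (g := fun t ω => U (ρ t ω) t ω)
    (h := fun t ω => U t t ω)]
  · refine integral_congr_ae (ae_of_all _ fun ω => ?_)
    simp only [adjS]
    rcases lt_trichotomy (a ω) (b ω) with h | h | h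
    · simp [h, h.le, h.ne, h.not_gt, h.not_ge]
    · simp [h]
    · simp [h, h.le, h.ne', h.not_gt, h.not_ge]
  · exact fun t ht => integrable_U μ 𝓕 hU hbd measurable_const (measurable_of_memT 𝓕 T (hτ t ht).1)
  · exact fun t ht => integrable_U μ 𝓕 hU hbd (measurable_of_memT 𝓕 T (hρ t ht).1) measurable_const
  · exact fun t ht => integrable_U μ 𝓕 hU hbd measurable_const measurable_const

lemma uPay_eq [IsProbabilityMeasure μ] {U : ℕ → ℕ → Ω → ℝ}
    (hU : ∀ s t, Measurable[𝓕 (max s t)] (U s t)) (hbd : ∃ C, ∀ s t ω, |U s t ω| ≤ C)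
    {α β : ℝ → Ω → ℕ} (ha : MemTr 𝓕 T α) (hb : MemTr 𝓕 T β) {ρ τ : ℕ → Ω → ℕ}
    (hρ : MemTTa 𝓕 T ρ) (hτ : MemTTa 𝓕 T τ) :
    uPay μ U α ρ β τ = utilde μ (Xproc μ 𝓕 U τ) (Yproc μ 𝓕 U ρ) (Zproc U) α β := by
  unfold uPay utilde
  congr 1
  ext p
  congr 1
  ext q
  rw [gam_sum μ 𝓕 T hU hbd (ha.2 p) (hb.2 q) hρ hτ, dyn_sum μ 𝓕 T (ha.2 p) (hb.2 q)]
  · refine Finset.sum_congr rfl fun t ht => ?_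
    have ht : t ≤ T := by simpa [Nat.lt_succ_iff] using ht
    unfold Xproc Yproc Zproc
    rw [setIntegral_condExp (𝓕.le t) _ (measurableSet_A 𝓕 T (ha.2 p) (hb.2 q) t),
      setIntegral_condExp (𝓕.le t) _ (measurableSet_A 𝓕 T (hb.2 q) (ha.2 p) t)]
    · exact integrable_U μ 𝓕 hU hbd (measurable_of_memT 𝓕 T (hρ t ht).1) measurable_const
    · exact integrable_U μ 𝓕 hU hbd measurable_const (measurable_of_memT 𝓕 T (hτ t ht).1)
  · exact fun t ht => integrable_condExp
  · exact fun t ht => integrable_condExp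
  · exact fun t ht => integrable_U μ 𝓕 hU hbd measurable_const measurable_const

lemma setIntegral_le_of_condExp [IsProbabilityMeasure μ] {f g : Ω → ℝ} (hf : Integrable f μ)
    (hg : Integrable g μ) {t : ℕ} (h : μ[f | 𝓕 t] ≤ᵐ[μ] μ[g | 𝓕 t]) {s : Set Ω}
    (hs : MeasurableSet[𝓕 t] s) : ∫ ω in s, f ω ∂μ ≤ ∫ ω in s, g ω ∂μ := by
  rw [← setIntegral_condExp (𝓕.le t) hf hs, ← setIntegral_condExp (𝓕.le t) hg hs]
  exact setIntegral_mono_ae integrable_condExp.integrableOn integrable_condExp.integrableOn h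

lemma gam_meas [IsProbabilityMeasure μ] {U : ℕ → ℕ → Ω → ℝ}
    (hU : ∀ s t, Measurable[𝓕 (max s t)] (U s t))
    {α β : ℝ → Ω → ℕ} (ha : MemTr 𝓕 T α) (hb : MemTr 𝓕 T β) {ρ τ : ℕ → Ω → ℕ}
    (hρ : MemTTa 𝓕 T ρ) (hτ : MemTTa 𝓕 T τ) :
    StronglyMeasurable (fun x : ℝ × ℝ => Gam μ U (α x.1) ρ (β x.2) τ) := by
  have key : ∀ {ρ : ℕ → Ω → ℕ}, MemTTa 𝓕 T ρ →
      Measurable (fun x : ℕ × Ω => ρ (min x.1 T) x.2) := fun {ρ} hρ =>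
    measurable_from_prod_countable_right fun t =>
      measurable_of_memT 𝓕 T (hρ (min t T) (min_le_right _ _)).1
  have hα : Measurable (fun x : (ℝ × ℝ) × Ω => α x.1.1 x.2) :=
    ha.1.comp ((measurable_fst.comp measurable_fst).prodMk measurable_snd)
  have hβ : Measurable (fun x : (ℝ × ℝ) × Ω => β x.1.2 x.2) :=
    hb.1.comp ((measurable_snd.comp measurable_fst).prodMk measurable_snd)
  have m1 : Measurable (fun x : (ℝ × ℝ) × Ω => adjS (α x.1.1) ρ (β x.1.2) x.2) := by
    have : Measurable (fun x : (ℝ × ℝ) × Ω => if α x.1.1 x.2 ≤ β x.1.2 x.2 then α x.1.1 x.2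
        else ρ (min (β x.1.2 x.2) T) x.2) := Measurable.ite
      (measurableSet_le hα hβ) hα ((key hρ).comp (hβ.prodMk measurable_snd))
    convert this using 2 with x
    simp [adjS, min_eq_left ((hb.2 x.1.2).2 x.2)]
  have m2 : Measurable (fun x : (ℝ × ℝ) × Ω => adjS (β x.1.2) τ (α x.1.1) x.2) := by
    have : Measurable (fun x : (ℝ × ℝ) × Ω => if β x.1.2 x.2 ≤ α x.1.1 x.2 then β x.1.2 x.2
        else τ (min (α x.1.1 x.2) T) x.2) := Measurable.ite
      (measurableSet_le hβ hα) hβ ((key hτ).comp (hα.prodMk measurable_snd))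
    convert this using 2 with x
    simp [adjS, min_eq_left ((ha.2 x.1.1).2 x.2)]
  have m := (measurable_unc 𝓕 hU).comp ((m1.prodMk m2).prodMk measurable_snd)
  exact m.stronglyMeasurable.integral_prod_right'

lemma uPay_mono [IsProbabilityMeasure μ] {U : ℕ → ℕ → Ω → ℝ}
    (hU : ∀ s t, Measurable[𝓕 (max s t)] (U s t)) (hbd : ∃ C, ∀ s t ω, |U s t ω| ≤ C)
    {α β : ℝ → Ω → ℕ} (ha : MemTr 𝓕 T α) (hb : MemTr 𝓕 T β) {ρ τ ρ' τ' : ℕ → Ω → ℕ}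
    (hρ : MemTTa 𝓕 T ρ) (hτ : MemTTa 𝓕 T τ) (hρ' : MemTTa 𝓕 T ρ') (hτ' : MemTTa 𝓕 T τ')
    (hle : ∀ p q, Gam μ U (α p) ρ (β q) τ ≤ Gam μ U (α p) ρ' (β q) τ') :
    uPay μ U α ρ β τ ≤ uPay μ U α ρ' β τ' := by
  obtain ⟨C, hC⟩ := hbd
  have bd : ∀ ρ τ p q, ‖Gam μ U (α p) ρ (β q) τ‖ ≤ C := by
    intro ρ τ p q
    have := norm_integral_le_of_norm_le_const (μ := μ) (C := C)
      (f := fun ω => U (adjS (α p) ρ (β q) ω) (adjS (β q) τ (α p) ω) ω)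
      (ae_of_all _ fun ω => by simpa using hC _ _ ω)
    simpa [Gam] using this
  have i1 : ∀ {ρ τ}, MemTTa 𝓕 T ρ → MemTTa 𝓕 T τ → ∀ p,
      Integrable (fun q => Gam μ U (α p) ρ (β q) τ) (volume.restrict (Icc (0:ℝ) 1)) :=
    fun {ρ τ} hρ hτ p => Integrable.of_bound (C := C)
      ((gam_meas μ 𝓕 T hU ha hb hρ hτ).comp_measurable
        (measurable_const.prodMk measurable_id)).aestronglyMeasurable
      (ae_of_all _ fun q => bd ρ τ p q)
  have i2 : ∀ {ρ τ}, MemTTa 𝓕 T ρ → MemTTa 𝓕 T τ →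
      Integrable (fun p => ∫ q in Icc (0:ℝ) 1, Gam μ U (α p) ρ (β q) τ)
        (volume.restrict (Icc (0:ℝ) 1)) := by
    intro ρ τ hρ hτ
    refine Integrable.of_bound (C := C)
      (gam_meas μ 𝓕 T hU ha hb hρ hτ).integral_prod_right'.aestronglyMeasurable
      (ae_of_all _ fun p => ?_)
    have := norm_integral_le_of_norm_le_const (μ := volume.restrict (Icc (0:ℝ) 1)) (C := C)
      (f := fun q => Gam μ U (α p) ρ (β q) τ) (ae_of_all _ fun q => bd ρ τ p q)
    simpa using this
  exact integral_mono (i2 hρ hτ) (i2 hρ' hτ') fun p =>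
    integral_mono (i1 hρ hτ p) (i1 hρ' hτ' p) fun q => hle p q

/-- if `ρ₁*, τ₁*` are stage-wise optimizers and `(α*, β*)` is a Nash
equilibrium of the auxiliary randomized Dynkin game `ũ`, then
`((α*,ρ₁*), (β*,τ₁*))` is a Nash equilibrium in mixed type-A strategies for the
original game `u`. -/
theorem nash_from_dynkin_nash
    [MeasurableSpace.CountablyGenerated Ω] [IsProbabilityMeasure μ]
    (U1 U2 : ℕ → ℕ → Ω → ℝ)
    (hU1m : ∀ s t, Measurable[𝓕 (max s t)] (U1 s t))
    (hU2m : ∀ s t, Measurable[𝓕 (max s t)] (U2 s t))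
    (hU1b : ∃ C, ∀ s t ω, |U1 s t ω| ≤ C)
    (hU2b : ∃ C, ∀ s t ω, |U2 s t ω| ≤ C)
    (ρ1s τ1s : ℕ → Ω → ℕ)
    (hρ1s : MemTTa 𝓕 T ρ1s) (hτ1s : MemTTa 𝓕 T τ1s)
    (hρ1opt : ∀ t ≤ T, ∀ σ : Ω → ℕ, MemTgePlus 𝓕 T t σ →
      μ[fun ω => U1 (σ ω) t ω | 𝓕 t] ≤ᵐ[μ] μ[fun ω => U1 (ρ1s t ω) t ω | 𝓕 t])
    (hτ1opt : ∀ t ≤ T, ∀ σ : Ω → ℕ, MemTgePlus 𝓕 T t σ →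
      μ[fun ω => U2 t (σ ω) ω | 𝓕 t] ≤ᵐ[μ] μ[fun ω => U2 t (τ1s t ω) ω | 𝓕 t])
    (αs βs : ℝ → Ω → ℕ) (hαs : MemTr 𝓕 T αs) (hβs : MemTr 𝓕 T βs)
    (hNash1 : ∀ α : ℝ → Ω → ℕ, MemTr 𝓕 T α →
      utilde μ (Xproc μ 𝓕 U1 τ1s) (Yproc μ 𝓕 U1 ρ1s) (Zproc U1) α βs ≤
      utilde μ (Xproc μ 𝓕 U1 τ1s) (Yproc μ 𝓕 U1 ρ1s) (Zproc U1) αs βs)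
    (hNash2 : ∀ β : ℝ → Ω → ℕ, MemTr 𝓕 T β →
      utilde μ (Xproc μ 𝓕 U2 τ1s) (Yproc μ 𝓕 U2 ρ1s) (Zproc U2) αs β ≤
      utilde μ (Xproc μ 𝓕 U2 τ1s) (Yproc μ 𝓕 U2 ρ1s) (Zproc U2) αs βs) :
    (∀ (α : ℝ → Ω → ℕ) (ρ1 : ℕ → Ω → ℕ), MemTr 𝓕 T α → MemTTa 𝓕 T ρ1 →
      uPay μ U1 α ρ1 βs τ1s ≤ uPay μ U1 αs ρ1s βs τ1s) ∧
    (∀ (β : ℝ → Ω → ℕ) (τ1 : ℕ → Ω → ℕ), MemTr 𝓕 T β → MemTTa 𝓕 T τ1 →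
      uPay μ U2 αs ρ1s β τ1 ≤ uPay μ U2 αs ρ1s βs τ1s) := by
  constructor
  · intro α ρ1 hα hρ1
    refine (uPay_mono μ 𝓕 T hU1m hU1b hα hβs hρ1 hτ1s hρ1s hτ1s ?_).trans ?_
    · intro p q
      rw [gam_sum μ 𝓕 T hU1m hU1b (hα.2 p) (hβs.2 q) hρ1 hτ1s,
        gam_sum μ 𝓕 T hU1m hU1b (hα.2 p) (hβs.2 q) hρ1s hτ1s]
      refine Finset.sum_le_sum fun t ht => ?_
      have ht : t ≤ T := by simpa [Nat.lt_succ_iff] using ht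
      gcongr ?_ + ?_ + ?_
      · exact le_rfl
      · exact setIntegral_le_of_condExp μ 𝓕
          (integrable_U μ 𝓕 hU1m hU1b (measurable_of_memT 𝓕 T (hρ1 t ht).1) measurable_const)
          (integrable_U μ 𝓕 hU1m hU1b (measurable_of_memT 𝓕 T (hρ1s t ht).1) measurable_const)
          (hρ1opt t ht _ (hρ1 t ht)) (measurableSet_A 𝓕 T (hβs.2 q) (hα.2 p) t)
      · exact le_rfl
    · rw [uPay_eq μ 𝓕 T hU1m hU1b hα hβs hρ1s hτ1s, uPay_eq μ 𝓕 T hU1m hU1b hαs hβs hρ1s hτ1s]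
      exact hNash1 α hα
  · intro β τ1 hβ hτ1
    refine (uPay_mono μ 𝓕 T hU2m hU2b hαs hβ hρ1s hτ1 hρ1s hτ1s ?_).trans ?_
    · intro p q
      rw [gam_sum μ 𝓕 T hU2m hU2b (hαs.2 p) (hβ.2 q) hρ1s hτ1,
        gam_sum μ 𝓕 T hU2m hU2b (hαs.2 p) (hβ.2 q) hρ1s hτ1s]
      refine Finset.sum_le_sum fun t ht => ?_
      have ht : t ≤ T := by simpa [Nat.lt_succ_iff] using ht
      gcongr ?_ + ?_ + ?_
      · exact setIntegral_le_of_condExp μ 𝓕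
          (integrable_U μ 𝓕 hU2m hU2b measurable_const (measurable_of_memT 𝓕 T (hτ1 t ht).1))
          (integrable_U μ 𝓕 hU2m hU2b measurable_const (measurable_of_memT 𝓕 T (hτ1s t ht).1))
          (hτ1opt t ht _ (hτ1 t ht)) (measurableSet_A 𝓕 T (hαs.2 p) (hβ.2 q) t)
      · exact le_rfl
      · exact le_rfl
    · rw [uPay_eq μ 𝓕 T hU2m hU2b hαs hβ hρ1s hτ1s, uPay_eq μ 𝓕 T hU2m hU2b hαs hβs hρ1s hτ1s]
      exact hNash2 β hβ

end
end

section
/- Suppose for each t ∈ {0,…,T} there are ρ*_1(t) ∈ 𝒯_{t+} and τ*_1(t) ∈ 𝒯_{t+} such that E_t[U^1(σ, t)] ≤ E_t[U^1(ρ*_1(t), t)] a.s. for every σ ∈ 𝒯_{t+}. Define X^1_t := E_t[U^1(t, τ*_1(t))], Y^1_t := E_t[U^1(ρ*_1(t), t)], Z^1_t := U^1(t,t). Then for every mixed strategy ρ = (α, ρ_1) ∈ 𝔗^{ar} and every β ∈ 𝒯^r, u^1(ρ, (β, τ*_1)) ≤ ũ^1(α, β). -/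
open MeasureTheory Set

section

variable {Ω : Type*} {m0 : MeasurableSpace Ω} (μ : Measure Ω) (𝓕 : Filtration ℕ m0) (T : ℕ)

/-- Joint measurability of a countable family. -/
lemma aux_meas_comp {Ω S : Type*} {m0 : MeasurableSpace Ω} [MeasurableSpace S]
    (U : ℕ → ℕ → Ω → ℝ) (hU : ∀ s t, Measurable (U s t))
    (f g : S → ℕ) (h : S → Ω) (hf : Measurable f) (hg : Measurable g) (hh : Measurable h) :
    Measurable (fun x => U (f x) (g x) (h x)) := by
  have h1 : Measurable (fun z : (ℕ × ℕ) × Ω => U z.1.1 z.1.2 z.2) :=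
    measurable_from_prod_countable_right (fun y => hU y.1 y.2)
  exact h1.comp ((hf.prodMk hg).prodMk hh)

lemma aux_meas_st {Ω : Type*} {m0 : MeasurableSpace Ω} (𝓕 : Filtration ℕ m0) (T : ℕ)
    (a : Ω → ℕ) (ha : MemT 𝓕 T a) : Measurable a := by
  refine measurable_to_countable' fun t => ?_
  have := 𝓕.le t _ (ha.1.measurableSet_eq t)
  convert this using 1
  ext ω
  simp

lemma aux_set_eq {Ω : Type*} {m0 : MeasurableSpace Ω} (𝓕 : Filtration ℕ m0) (T : ℕ)
    (a : Ω → ℕ) (ha : MemT 𝓕 T a) (t : ℕ) : MeasurableSet[𝓕 t] {ω | a ω = t} := by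
  have := ha.1.measurableSet_eq t
  convert this using 1
  ext ω
  simp

lemma aux_set_gt {Ω : Type*} {m0 : MeasurableSpace Ω} (𝓕 : Filtration ℕ m0) (T : ℕ)
    (a : Ω → ℕ) (ha : MemT 𝓕 T a) (t : ℕ) : MeasurableSet[𝓕 t] {ω | t < a ω} := by
  have := ha.1.measurableSet_gt t
  convert this using 1
  ext ω
  simp

/-- Decomposition of the Dynkin payoff along the stage. -/
lemma aux_decomp {Ω : Type*} {m0 : MeasurableSpace Ω} (μ : Measure Ω) (𝓕 : Filtration ℕ m0)
    (T : ℕ) (a b : Ω → ℕ) (ha : MemT 𝓕 T a) (hb : MemT 𝓕 T b) (x y z : ℕ → Ω → ℝ)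
    (hx : ∀ t ≤ T, Integrable (x t) μ) (hy : ∀ t ≤ T, Integrable (y t) μ)
    (hz : ∀ t ≤ T, Integrable (z t) μ) :
    ∫ ω, ((if a ω < b ω then x (a ω) ω else 0) + (if b ω < a ω then y (b ω) ω else 0) +
      (if a ω = b ω then z (a ω) ω else 0)) ∂μ =
    ∑ t ∈ Finset.range (T + 1),
      (∫ ω in {ω | a ω = t} ∩ {ω | t < b ω}, x t ω ∂μ
        + ∫ ω in {ω | b ω = t} ∩ {ω | t < a ω}, y t ω ∂μ
        + ∫ ω in {ω | a ω = t} ∩ {ω | b ω = t}, z t ω ∂μ) := by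
  have m1 : ∀ t, MeasurableSet ({ω | a ω = t} ∩ {ω | t < b ω}) := fun t =>
    𝓕.le t _ ((aux_set_eq 𝓕 T a ha t).inter (aux_set_gt 𝓕 T b hb t))
  have m2 : ∀ t, MeasurableSet ({ω | b ω = t} ∩ {ω | t < a ω}) := fun t =>
    𝓕.le t _ ((aux_set_eq 𝓕 T b hb t).inter (aux_set_gt 𝓕 T a ha t))
  have m3 : ∀ t, MeasurableSet ({ω | a ω = t} ∩ {ω | b ω = t}) := fun t =>
    𝓕.le t _ ((aux_set_eq 𝓕 T a ha t).inter (aux_set_eq 𝓕 T b hb t))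
  have key : ∀ t ∈ Finset.range (T + 1),
      (∫ ω in {ω | a ω = t} ∩ {ω | t < b ω}, x t ω ∂μ
        + ∫ ω in {ω | b ω = t} ∩ {ω | t < a ω}, y t ω ∂μ
        + ∫ ω in {ω | a ω = t} ∩ {ω | b ω = t}, z t ω ∂μ) =
      ∫ ω, (({ω | a ω = t} ∩ {ω | t < b ω}).indicator (x t) ω
        + ({ω | b ω = t} ∩ {ω | t < a ω}).indicator (y t) ω
        + ({ω | a ω = t} ∩ {ω | b ω = t}).indicator (z t) ω) ∂μ := by
    intro t ht
    have ht' : t ≤ T := by simpa [Nat.lt_succ_iff] using ht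
    have e1 := ((hx t ht').indicator (m1 t)).add ((hy t ht').indicator (m2 t))
    refine Eq.trans ?_ (integral_add e1 ((hz t ht').indicator (m3 t))).symm
    have e2 := integral_add ((hx t ht').indicator (m1 t)) ((hy t ht').indicator (m2 t))
    simp only [Pi.add_apply]
    rw [e2, integral_indicator (m1 t), integral_indicator (m2 t), integral_indicator (m3 t)]
  rw [Finset.sum_congr rfl key, ← integral_finsetSum]
  · refine integral_congr_ae (Filter.Eventually.of_forall fun ω => ?_)
    have h1 := ha.2 ω
    have h2 := hb.2 ω
    simp only [Finset.sum_add_distrib, Set.indicator_apply, Set.mem_inter_iff, Set.mem_ofPred_eq,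
      ite_and]
    rw [Finset.sum_ite_eq, Finset.sum_ite_eq, Finset.sum_ite_eq]
    simp only [Finset.mem_range, Nat.lt_succ_iff, h1, h2, if_true, eq_comm]
  · intro t ht
    have ht' : t ≤ T := by simpa [Nat.lt_succ_iff] using ht
    exact (((hx t ht').indicator (m1 t)).add ((hy t ht').indicator (m2 t))).add
      ((hz t ht').indicator (m3 t))

lemma aux_Gam_eq {Ω : Type*} {m0 : MeasurableSpace Ω} (μ : Measure Ω)
    (U : ℕ → ℕ → Ω → ℝ) (a b : Ω → ℕ) (r s : ℕ → Ω → ℕ) :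
    Gam μ U a r b s = ∫ ω, ((if a ω < b ω then (fun t ω => U t (s t ω) ω) (a ω) ω else 0)
      + (if b ω < a ω then (fun t ω => U (r t ω) t ω) (b ω) ω else 0) +
      (if a ω = b ω then Zproc U (a ω) ω else 0)) ∂μ := by
  unfold Gam
  refine integral_congr_ae (Filter.Eventually.of_forall fun ω => ?_)
  simp only [adjS, Zproc]
  rcases lt_trichotomy (a ω) (b ω) with h | h | h
  · simp [h, h.le, h.not_ge, h.not_gt, h.ne]
  · simp [h]
  · simp [h, h.le, h.not_ge, h.not_gt, h.ne']

lemma aux_int {Ω : Type*} {m0 : MeasurableSpace Ω} (μ : Measure Ω) [IsProbabilityMeasure μ]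
    (U : ℕ → ℕ → Ω → ℝ) (hU : ∀ s t, Measurable (U s t)) (C : ℝ)
    (hC : ∀ s t ω, |U s t ω| ≤ C) (f g : Ω → ℕ) (hf : Measurable f) (hg : Measurable g) :
    Integrable (fun ω => U (f ω) (g ω) ω) μ :=
  Integrable.of_bound (aux_meas_comp U hU f g id hf hg measurable_id).aestronglyMeasurable C
    (Filter.Eventually.of_forall fun ω => hC _ _ _)

lemma aux_Gam_int {Ω : Type*} {m0 : MeasurableSpace Ω} (μ : Measure Ω) [IsProbabilityMeasure μ]
    (𝓕 : Filtration ℕ m0) (T : ℕ)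
    (U : ℕ → ℕ → Ω → ℝ) (hU : ∀ s t, Measurable (U s t)) (C : ℝ)
    (hC : ∀ s t ω, |U s t ω| ≤ C) (α β : ℝ → Ω → ℕ) (r s : ℕ → Ω → ℕ)
    (hα : MemTr 𝓕 T α) (hβ : MemTr 𝓕 T β) (hr : MemTTa 𝓕 T r) (hs : MemTTa 𝓕 T s)
    (ν : Measure (ℝ × ℝ)) [IsFiniteMeasure ν] :
    Integrable (fun z : ℝ × ℝ => Gam μ U (α z.1) r (β z.2) s) ν := by
  have adjm : ∀ (f g : (ℝ × ℝ) × Ω → ℕ) (k : ℕ → Ω → ℕ), Measurable f → Measurable g →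
      (∀ x, g x ≤ T) → MemTTa 𝓕 T k →
      Measurable (fun x => if f x ≤ g x then f x else k (g x) x.2) := by
    intro f g k hf hg hgT hk
    refine Measurable.ite (measurableSet_le hf hg) hf ?_
    have h1 : Measurable (fun z : ℕ × Ω => k (min z.1 T) z.2) :=
      measurable_from_prod_countable_right
        (fun t => aux_meas_st 𝓕 T _ (hk (min t T) (min_le_right _ _)).1)
    have h2 := h1.comp (hg.prodMk measurable_snd)
    convert h2 using 2 with x
    simp [hgT x]
  have hA : Measurable (fun x : (ℝ × ℝ) × Ω => α x.1.1 x.2) :=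
    hα.1.comp ((measurable_fst.comp measurable_fst).prodMk measurable_snd)
  have hB : Measurable (fun x : (ℝ × ℝ) × Ω => β x.1.2 x.2) :=
    hβ.1.comp ((measurable_snd.comp measurable_fst).prodMk measurable_snd)
  have hm : Measurable (fun x : (ℝ × ℝ) × Ω =>
      U (adjS (α x.1.1) r (β x.1.2) x.2) (adjS (β x.1.2) s (α x.1.1) x.2) x.2) :=
    aux_meas_comp U hU _ _ _ (adjm _ _ r hA hB (fun x => (hβ.2 _).2 _) hr)
      (adjm _ _ s hB hA (fun x => (hα.2 _).2 _) hs) measurable_snd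
  refine Integrable.of_bound
    (hm.stronglyMeasurable.integral_prod_right' (ν := μ)).aestronglyMeasurable C
    (Filter.Eventually.of_forall fun z => ?_)
  have := norm_integral_le_of_norm_le_const (μ := μ) (C := C)
    (f := fun ω => U (adjS (α z.1) r (β z.2) ω) (adjS (β z.2) s (α z.1) ω) ω)
    (Filter.Eventually.of_forall fun ω => hC _ _ _)
  simpa [Gam] using this

/-- if `ρ₁*` is a stage-wise optimizer for player 1 (and
`τ₁*(t) ∈ 𝒯_{t+}`), then for every mixed strategy `ρ = (α,ρ₁) ∈ 𝔗^{ar}` and every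
randomized stopping time `β ∈ 𝒯^r`, the original payoff `u¹(ρ, (β,τ₁*))` is
dominated by the auxiliary Dynkin payoff `ũ¹(α, β)`. -/
theorem uPay_le_utilde
    [MeasurableSpace.CountablyGenerated Ω] [IsProbabilityMeasure μ]
    (U1 : ℕ → ℕ → Ω → ℝ)
    (hU1m : ∀ s t, Measurable[𝓕 (max s t)] (U1 s t))
    (hU1b : ∃ C, ∀ s t ω, |U1 s t ω| ≤ C)
    (ρ1s τ1s : ℕ → Ω → ℕ)
    (hρ1s : MemTTa 𝓕 T ρ1s) (hτ1s : MemTTa 𝓕 T τ1s)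
    (hρ1opt : ∀ t ≤ T, ∀ σ : Ω → ℕ, MemTgePlus 𝓕 T t σ →
      μ[fun ω => U1 (σ ω) t ω | 𝓕 t] ≤ᵐ[μ] μ[fun ω => U1 (ρ1s t ω) t ω | 𝓕 t])
    (α : ℝ → Ω → ℕ) (ρ1 : ℕ → Ω → ℕ) (hα : MemTr 𝓕 T α) (hρ1 : MemTTa 𝓕 T ρ1)
    (β : ℝ → Ω → ℕ) (hβ : MemTr 𝓕 T β) :
    uPay μ U1 α ρ1 β τ1s ≤
      utilde μ (Xproc μ 𝓕 U1 τ1s) (Yproc μ 𝓕 U1 ρ1s) (Zproc U1) α β := by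
  obtain ⟨C, hC⟩ := hU1b
  have hU : ∀ s t, Measurable (U1 s t) := fun s t => (hU1m s t).mono (𝓕.le _) le_rfl
  have ix : ∀ k, MemTTa 𝓕 T k → ∀ t ≤ T, Integrable (fun ω => U1 t (k t ω) ω) μ :=
    fun k hk t ht => aux_int μ U1 hU C hC _ _ measurable_const (aux_meas_st 𝓕 T _ (hk t ht).1)
  have iy : ∀ k, MemTTa 𝓕 T k → ∀ t ≤ T, Integrable (fun ω => U1 (k t ω) t ω) μ :=
    fun k hk t ht => aux_int μ U1 hU C hC _ _ (aux_meas_st 𝓕 T _ (hk t ht).1) measurable_const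
  have iz : ∀ t ≤ T, Integrable (Zproc U1 t) μ :=
    fun t _ => aux_int μ U1 hU C hC (fun _ => t) (fun _ => t) measurable_const measurable_const
  have hut : utilde μ (Xproc μ 𝓕 U1 τ1s) (Yproc μ 𝓕 U1 ρ1s) (Zproc U1) α β =
      uPay μ U1 α ρ1s β τ1s := by
    unfold utilde uPay
    congr 1 with p
    congr 1 with q
    rw [aux_Gam_eq, aux_decomp μ 𝓕 T _ _ (hα.2 p) (hβ.2 q)
        (Xproc μ 𝓕 U1 τ1s) (Yproc μ 𝓕 U1 ρ1s) _
        (fun t _ => integrable_condExp) (fun t _ => integrable_condExp) iz,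
      aux_decomp μ 𝓕 T _ _ (hα.2 p) (hβ.2 q) _ _ _ (ix _ hτ1s) (iy _ hρ1s) iz]
    refine Finset.sum_congr rfl fun t ht => ?_
    have ht' : t ≤ T := by simpa [Nat.lt_succ_iff] using ht
    unfold Xproc Yproc
    rw [setIntegral_condExp (𝓕.le t) (ix _ hτ1s t ht')
        ((aux_set_eq 𝓕 T _ (hα.2 p) t).inter (aux_set_gt 𝓕 T _ (hβ.2 q) t)),
      setIntegral_condExp (𝓕.le t) (iy _ hρ1s t ht')
        ((aux_set_eq 𝓕 T _ (hβ.2 q) t).inter (aux_set_gt 𝓕 T _ (hα.2 p) t))]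
  rw [hut]
  have hle : ∀ p q, Gam μ U1 (α p) ρ1 (β q) τ1s ≤ Gam μ U1 (α p) ρ1s (β q) τ1s := by
    intro p q
    rw [aux_Gam_eq, aux_Gam_eq,
      aux_decomp μ 𝓕 T _ _ (hα.2 p) (hβ.2 q) _ _ _ (ix _ hτ1s) (iy _ hρ1) iz,
      aux_decomp μ 𝓕 T _ _ (hα.2 p) (hβ.2 q) _ _ _ (ix _ hτ1s) (iy _ hρ1s) iz]
    refine Finset.sum_le_sum fun t ht => ?_
    have ht' : t ≤ T := by simpa [Nat.lt_succ_iff] using ht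
    have hs := (aux_set_eq 𝓕 T _ (hβ.2 q) t).inter (aux_set_gt 𝓕 T _ (hα.2 p) t)
    rw [← setIntegral_condExp (𝓕.le t) (iy _ hρ1 t ht') hs,
      ← setIntegral_condExp (𝓕.le t) (iy _ hρ1s t ht') hs]
    gcongr ?_ + ?_ + ?_
    · exact le_rfl
    · exact setIntegral_mono_ae integrable_condExp.integrableOn integrable_condExp.integrableOn
        (hρ1opt t ht' _ (hρ1 t ht'))
    · exact le_rfl
  have i1 := aux_Gam_int μ 𝓕 T U1 hU C hC α β ρ1 τ1s hα hβ hρ1 hτ1s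
    ((volume.restrict (Icc (0:ℝ) 1)).prod (volume.restrict (Icc (0:ℝ) 1)))
  have i2 := aux_Gam_int μ 𝓕 T U1 hU C hC α β ρ1s τ1s hα hβ hρ1s hτ1s
    ((volume.restrict (Icc (0:ℝ) 1)).prod (volume.restrict (Icc (0:ℝ) 1)))
  unfold uPay
  rw [← integral_prod _ i1, ← integral_prod _ i2]
  exact integral_mono i1 i2 fun z => hle z.1 z.2

end
end

section
/- There exists a Nash equilibrium in pure stopping strategies for the sequential-move non-zero-sum stopping game: there is a pair (ρ*, τ*) ∈ 𝔗^a × 𝔗^b such that w^1(ρ, τ*) ≤ w^1(ρ*, τ*) for every ρ ∈ 𝔗^a and w^2(ρ*, τ) ≤ w^2(ρ*, τ*) for every τ ∈ 𝔗^b. -/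
open MeasureTheory Set

section

variable {Ω : Type*} {m0 : MeasurableSpace Ω} (μ : Measure Ω) (𝓕 : Filtration ℕ m0) (T : ℕ)

/-- `τ ∈ 𝒯_t`: a stopping time with `τ ≥ t`. -/
def MemTge (t : ℕ) (τ : Ω → ℕ) : Prop :=
  MemT 𝓕 T τ ∧ ∀ ω, t ≤ τ ω

/-- `ψ ∈ 𝕋^b`: `ψ(t,·) ∈ 𝒯_t` for every stage `t`. -/
def MemTTb (ψ : ℕ → Ω → ℕ) : Prop :=
  ∀ t ≤ T, MemTge 𝓕 T t (ψ t)

/-- `ρ = (ρ₀,ρ₁) ∈ 𝔗^a`: a pure stopping strategy of type A. -/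
def MemSA (ρ : (Ω → ℕ) × (ℕ → Ω → ℕ)) : Prop :=
  MemT 𝓕 T ρ.1 ∧ MemTTa 𝓕 T ρ.2

/-- `τ = (τ₀,τ₁) ∈ 𝔗^b`: a pure stopping strategy of type B. -/
def MemSB (τ : (Ω → ℕ) × (ℕ → Ω → ℕ)) : Prop :=
  MemT 𝓕 T τ.1 ∧ MemTTb 𝓕 T τ.2

/-- `ρ⟨τ⟩ = ρ₀ 1_{ρ₀ ≤ τ₀} + ρ₁(τ₀) 1_{ρ₀ > τ₀}`. -/
def adjA (ρ τ : (Ω → ℕ) × (ℕ → Ω → ℕ)) : Ω → ℕ :=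
  fun ω => if ρ.1 ω ≤ τ.1 ω then ρ.1 ω else ρ.2 (τ.1 ω) ω

/-- `τ⟨ρ⟩ = τ₀ 1_{τ₀ < ρ₀} + τ₁(ρ₀) 1_{τ₀ ≥ ρ₀}`. -/
def adjB (τ ρ : (Ω → ℕ) × (ℕ → Ω → ℕ)) : Ω → ℕ :=
  fun ω => if τ.1 ω < ρ.1 ω then τ.1 ω else τ.2 (ρ.1 ω) ω

/-- `w(ρ,τ) = E[U(ρ⟨τ⟩, τ⟨ρ⟩)]`: the payoff of the sequential-move stopping game. -/
noncomputable def w (U : ℕ → ℕ → Ω → ℝ) (ρ τ : (Ω → ℕ) × (ℕ → Ω → ℕ)) : ℝ :=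
  ∫ ω, U (adjA ρ τ ω) (adjB τ ρ ω) ω ∂μ

/-- `inf {t ≥ σ : P(t,·) holds}`, with the convention that the infimum is `T`
if there is no such `t` in `{0,…,T}`. -/
noncomputable def hitTime (T : ℕ) (σ : Ω → ℕ) (P : ℕ → Ω → Prop) : Ω → ℕ :=
  fun ω => sInf ({t | σ ω ≤ t ∧ P t ω} ∪ {T})

def BdM {Ω : Type*} [MeasurableSpace Ω] (C : ℝ) (f : Ω → ℝ) : Prop := Measurable f ∧ ∀ ω, |f ω| ≤ C

def Opt (t : ℕ) (Z : ℕ → Ω → ℝ) (σ : Ω → ℕ) : Prop :=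
  MemTge 𝓕 T t σ ∧ ∀ σ', MemTge 𝓕 T t σ' → ∀ A, MeasurableSet[𝓕 t] A →
    ∫ ω in A, Z (σ' ω) ω ∂μ ≤ ∫ ω in A, Z (σ ω) ω ∂μ

def ZA (X Y : ℕ → Ω → ℝ) (τ : Ω → ℕ) : ℕ → Ω → ℝ :=
  fun s ω => if s ≤ τ ω then X s ω else Y (τ ω) ω

def ZB (X Y : ℕ → Ω → ℝ) (ρ : Ω → ℕ) : ℕ → Ω → ℝ :=
  fun s ω => if s < ρ ω then Y s ω else X (ρ ω) ω

lemma memT_iff (τ : Ω → ℕ) : MemT 𝓕 T τ ↔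
    (∀ i, MeasurableSet[𝓕 i] {ω | τ ω ≤ i}) ∧ ∀ ω, τ ω ≤ T := by
  unfold MemT IsStoppingTime
  simp only [ENat.some_eq_natCast, Nat.cast_le]

lemma memT_const (t : ℕ) (h : t ≤ T) : MemT 𝓕 T (fun _ => t) := by
  rw [memT_iff]
  exact ⟨fun i => MeasurableSet.const _, fun _ => h⟩

lemma MemT.meas_le {𝓕 : Filtration ℕ m0} {T : ℕ} {τ : Ω → ℕ} (h : MemT 𝓕 T τ) {i j : ℕ}
    (hij : i ≤ j) : MeasurableSet[𝓕 j] {ω | τ ω ≤ i} :=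
  𝓕.mono hij _ (((memT_iff 𝓕 T τ).1 h).1 i)

lemma MemT.meas_eq {𝓕 : Filtration ℕ m0} {T : ℕ} {τ : Ω → ℕ} (h : MemT 𝓕 T τ) (i : ℕ) :
    MeasurableSet[𝓕 i] {ω | τ ω = i} := by
  rcases i with _ | i
  · convert h.meas_le (le_refl 0) using 2
    ext ω; simp
  · have := (h.meas_le (le_refl (i+1))).diff (h.meas_le (Nat.le_succ i))
    convert this using 1
    ext ω; simp; omega

lemma MemT.measurable {𝓕 : Filtration ℕ m0} {T : ℕ} {τ : Ω → ℕ} (h : MemT 𝓕 T τ) :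
    Measurable τ :=
  measurable_to_countable' fun i => 𝓕.le i _ (h.meas_eq i)

lemma BdM.comp {C : ℝ} {Z : ℕ → Ω → ℝ} (h : ∀ s, BdM C (Z s)) {σ : Ω → ℕ} (hσ : Measurable σ) :
    BdM C (fun ω => Z (σ ω) ω) := by
  refine ⟨?_, fun ω => (h _).2 ω⟩
  have : Measurable (fun p : ℕ × Ω => Z p.1 p.2) := measurable_from_prod_countable_right fun s => (h s).1
  exact this.comp (hσ.prodMk measurable_id)

lemma BdM.integrable {μ : Measure Ω} [IsProbabilityMeasure μ] {C : ℝ} {f : Ω → ℝ} (h : BdM C f) :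
    Integrable f μ :=
  Integrable.of_bound h.1.aestronglyMeasurable C (Filter.Eventually.of_forall h.2)

lemma BdM.ite {C : ℝ} {f g : Ω → ℝ} (hf : BdM C f) (hg : BdM C g) {p : Ω → Prop} [DecidablePred p]
    (hp : MeasurableSet {ω | p ω}) : BdM C (fun ω => if p ω then f ω else g ω) := by
  refine ⟨Measurable.ite hp hf.1 hg.1, fun ω => ?_⟩
  dsimp only
  split_ifs
  · exact hf.2 ω
  · exact hg.2 ω

lemma BdM.ZA {C : ℝ} {X Y : ℕ → Ω → ℝ} (hX : ∀ s, BdM C (X s)) (hY : ∀ s, BdM C (Y s))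
    {τ : Ω → ℕ} (hτ : Measurable τ) (s : ℕ) : BdM C (ZA X Y τ s) :=
  BdM.ite (hX s) (BdM.comp hY hτ) (measurableSet_le measurable_const hτ)

lemma BdM.ZB {C : ℝ} {X Y : ℕ → Ω → ℝ} (hX : ∀ s, BdM C (X s)) (hY : ∀ s, BdM C (Y s))
    {τ : Ω → ℕ} (hτ : Measurable τ) (s : ℕ) : BdM C (ZB X Y τ s) :=
  BdM.ite (hY s) (BdM.comp hX hτ) (measurableSet_lt measurable_const hτ)

variable {μ} in
lemma split_le {f g : Ω → ℝ} (hf : Integrable f μ) (hg : Integrable g μ) {A D : Set Ω}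
    (hD : MeasurableSet D) (h1 : ∫ ω in A ∩ D, f ω ∂μ ≤ ∫ ω in A ∩ D, g ω ∂μ)
    (h2 : ∫ ω in A ∩ Dᶜ, f ω ∂μ ≤ ∫ ω in A ∩ Dᶜ, g ω ∂μ) :
    ∫ ω in A, f ω ∂μ ≤ ∫ ω in A, g ω ∂μ := by
  rw [← integral_inter_add_sdiff hD (hf.integrableOn (s := A)),
    ← integral_inter_add_sdiff hD (hg.integrableOn (s := A)), sdiff_eq]
  exact add_le_add h1 h2

variable {μ} in
lemma sum_le {f g : Ω → ℝ} (hf : Integrable f μ) (hg : Integrable g μ) {σ : Ω → ℕ}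
    (hσ : Measurable σ) (hT : ∀ ω, σ ω ≤ T)
    (h : ∀ s ≤ T, ∫ ω in {ω | σ ω = s}, f ω ∂μ ≤ ∫ ω in {ω | σ ω = s}, g ω ∂μ) :
    ∫ ω, f ω ∂μ ≤ ∫ ω, g ω ∂μ := by
  have key : ∀ f : Ω → ℝ, Integrable f μ →
      ∫ ω, f ω ∂μ = ∑ s ∈ Finset.range (T+1), ∫ ω in {ω | σ ω = s}, f ω ∂μ := by
    intro f hf
    rw [← integral_biUnion_finset]
    · have : (⋃ i ∈ Finset.range (T+1), {ω | σ ω = i}) = univ := by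
        ext ω; simp; have := hT ω; omega
      rw [this, setIntegral_univ]
    · intro i _
      exact hσ (measurableSet_singleton i)
    · intro i _ j _ hij
      refine Set.disjoint_left.2 fun ω h1 h2 => hij ?_
      simp at h1 h2; omega
    · intro i _
      exact hf.integrableOn
  rw [key f hf, key g hg]
  refine Finset.sum_le_sum fun s hs => h s ?_
  simp at hs; omega

variable {μ} in
lemma setInt_congr {m : MeasurableSpace Ω} (hm : m ≤ m0) {f g : Ω → ℝ} {A : Set Ω}
    (hA : MeasurableSet[m] A)
    (h : ∀ ω ∈ A, f ω = g ω) : ∫ ω in A, f ω ∂μ = ∫ ω in A, g ω ∂μ :=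
  setIntegral_congr_fun (hm _ hA) h

lemma exists_sign [IsProbabilityMeasure μ] {m : MeasurableSpace Ω} (hm : m ≤ m0) {f g : Ω → ℝ}
    (hf : Integrable f μ) (hg : Integrable g μ) :
    ∃ D, MeasurableSet[m] D ∧ ∀ A, MeasurableSet[m] A →
      (A ⊆ D → ∫ ω in A, g ω ∂μ ≤ ∫ ω in A, f ω ∂μ) ∧
      (A ⊆ Dᶜ → ∫ ω in A, f ω ∂μ ≤ ∫ ω in A, g ω ∂μ) := by
  refine ⟨{ω | (μ[g|m]) ω ≤ (μ[f|m]) ω}, measurableSet_le stronglyMeasurable_condExp.measurable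
    stronglyMeasurable_condExp.measurable, fun A hA => ?_⟩
  rw [← setIntegral_condExp hm hf hA, ← setIntegral_condExp hm hg hA]
  constructor
  · intro h
    exact setIntegral_mono_on integrable_condExp.integrableOn integrable_condExp.integrableOn
      (hm _ hA) fun ω hω => h hω
  · intro h
    refine setIntegral_mono_on integrable_condExp.integrableOn integrable_condExp.integrableOn
      (hm _ hA) fun ω hω => ?_
    have := h hω
    simp at this
    exact this.le

open Classical in
noncomputable def pw (D : Set Ω) (t : ℕ) (σ : Ω → ℕ) : Ω → ℕ := fun ω => if ω ∈ D then t else σ ω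

lemma pw_mem {D : Set Ω} {t : ℕ} {σ : Ω → ℕ} {ω : Ω} (h : ω ∈ D) : pw D t σ ω = t := by
  simp [pw, h]

lemma pw_not_mem {D : Set Ω} {t : ℕ} {σ : Ω → ℕ} {ω : Ω} (h : ω ∉ D) : pw D t σ ω = σ ω := by
  simp [pw, h]

lemma memTge_pw {D : Set Ω} {t : ℕ} {σ : Ω → ℕ} (htT : t < T) (hD : MeasurableSet[𝓕 t] D)
    (hσ : MemTge 𝓕 T (t+1) σ) : MemTge 𝓕 T t (pw D t σ) := by
  refine ⟨(memT_iff _ _ _).2 ⟨fun i => ?_, fun ω => ?_⟩, fun ω => ?_⟩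
  · by_cases hi : t ≤ i
    · have : {ω | pw D t σ ω ≤ i} = D ∪ {ω | σ ω ≤ i} := by
        ext ω
        by_cases h : ω ∈ D
        · simp [pw, h, hi]
        · simp [pw, h]
      rw [this]
      exact (𝓕.mono hi _ hD).union (hσ.1.meas_le le_rfl)
    · have : {ω | pw D t σ ω ≤ i} = ∅ := by
        ext ω
        have := hσ.2 ω
        by_cases h : ω ∈ D
        · simp [pw, h]; omega
        · simp [pw, h]; omega
      rw [this]
      exact @MeasurableSet.empty _ (𝓕 i)
  · have := hσ.1.2 ω
    by_cases h : ω ∈ D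
    · simp [pw, h]; omega
    · simp [pw, h]; omega
  · have := hσ.2 ω
    by_cases h : ω ∈ D
    · simp [pw, h]
    · simp [pw, h]; omega

lemma memTge_max {t : ℕ} {σ : Ω → ℕ} (htT : t < T)
    (hσ : MemTge 𝓕 T t σ) : MemTge 𝓕 T (t+1) (fun ω => max (σ ω) (t+1)) := by
  refine ⟨(memT_iff _ _ _).2 ⟨fun i => ?_, fun ω => ?_⟩, fun ω => ?_⟩
  · by_cases hi : t + 1 ≤ i
    · simpa [hi] using hσ.1.meas_le (le_refl i)
    · simp [hi]
  · have := hσ.1.2 ω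
    simp; omega
  · simp

/-- one backward step of optimal stopping -/
lemma opt_step [IsProbabilityMeasure μ] {C : ℝ} {Z : ℕ → Ω → ℝ} (hZ : ∀ s, BdM C (Z s))
    {t : ℕ} (htT : t < T)
    {σ : Ω → ℕ} (hσ : Opt μ 𝓕 T (t+1) Z σ) {D : Set Ω} (hD : MeasurableSet[𝓕 t] D)
    (h : ∀ A, MeasurableSet[𝓕 t] A →
      (A ⊆ D → ∫ ω in A, Z (σ ω) ω ∂μ ≤ ∫ ω in A, Z t ω ∂μ) ∧
      (A ⊆ Dᶜ → ∫ ω in A, Z t ω ∂μ ≤ ∫ ω in A, Z (σ ω) ω ∂μ)) :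
    Opt μ 𝓕 T t Z (pw D t σ) := by
  have hp := memTge_pw 𝓕 T htT hD hσ.1
  refine ⟨hp, fun σ' hσ' A hA => ?_⟩
  have hE : MeasurableSet[𝓕 t] {ω | σ' ω = t} := hσ'.1.meas_eq t
  have hm := memTge_max 𝓕 T htT hσ'
  have i1 := (BdM.comp hZ hσ'.1.measurable).integrable (μ := μ)
  have i2 := (BdM.comp hZ hp.1.measurable).integrable (μ := μ)
  have hmax : ∀ ω, ω ∈ {ω | σ' ω = t}ᶜ → σ' ω = max (σ' ω) (t+1) := by
    intro ω hω
    have := hσ'.2 ω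
    simp at hω; omega
  refine split_le i1 i2 (𝓕.le _ _ hD) ?_ ?_
  · have hAD := hA.inter hD
    rw [setInt_congr (𝓕.le t) hAD (g := Z t) (f := fun ω => Z (pw D t σ ω) ω)
      (fun ω hω => by simp only [pw_mem hω.2])]
    refine split_le i1 (hZ t).integrable (𝓕.le _ _ hE) ?_ ?_
    · refine (setInt_congr (𝓕.le t) (hAD.inter hE) fun ω hω => ?_).le
      have : σ' ω = t := hω.2
      rw [this]
    · have hB := hAD.inter hE.compl
      rw [setInt_congr (𝓕.le t) hB (f := fun ω => Z (σ' ω) ω)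
        (g := fun ω => Z (max (σ' ω) (t+1)) ω) (fun ω hω => by
          rw [← hmax ω hω.2])]
      exact (hσ.2 _ hm _ (𝓕.mono (Nat.le_succ t) _ hB)).trans
        ((h _ hB).1 fun ω hω => hω.1.2)
  · have hAD := hA.inter hD.compl
    have i3 := (BdM.comp hZ hσ.1.1.measurable).integrable (μ := μ)
    rw [setInt_congr (𝓕.le t) hAD (g := fun ω => Z (σ ω) ω) (f := fun ω => Z (pw D t σ ω) ω)
      (fun ω hω => by simp only [pw_not_mem hω.2])]
    refine split_le i1 i3 (𝓕.le _ _ hE) ?_ ?_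
    · have hB := hAD.inter hE
      rw [setInt_congr (𝓕.le t) hB (f := fun ω => Z (σ' ω) ω) (g := Z t) (fun ω hω => by
          have : σ' ω = t := hω.2
          simp only [this])]
      exact (h _ hB).2 fun ω hω => hω.1.2
    · have hB := hAD.inter hE.compl
      rw [setInt_congr (𝓕.le t) hB (f := fun ω => Z (σ' ω) ω)
        (g := fun ω => Z (max (σ' ω) (t+1)) ω) (fun ω hω => by
          rw [← hmax ω hω.2])]
      exact hσ.2 _ hm _ (𝓕.mono (Nat.le_succ t) _ hB)

lemma memTge_T : MemTge 𝓕 T T (fun _ => T) := ⟨memT_const 𝓕 T T le_rfl, fun _ => le_rfl⟩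

lemma opt_T (Z : ℕ → Ω → ℝ) : Opt μ 𝓕 T T Z (fun _ => T) := by
  refine ⟨memTge_T 𝓕 T, fun σ hσ A _ => le_of_eq ?_⟩
  have : σ = fun _ => T := funext fun ω => le_antisymm (hσ.1.2 ω) (hσ.2 ω)
  rw [this]

lemma exists_opt [IsProbabilityMeasure μ] {C : ℝ} {Z : ℕ → Ω → ℝ} (hZ : ∀ s, BdM C (Z s))
    (t : ℕ) (ht : t ≤ T) : ∃ σ, Opt μ 𝓕 T t Z σ := by
  induction ht using Nat.decreasingInduction with
  | self => exact ⟨_, opt_T μ 𝓕 T Z⟩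
  | of_succ t ht ih =>
    obtain ⟨σ, hσ⟩ := ih
    obtain ⟨D, hD, h⟩ := exists_sign μ (𝓕.le t) ((hZ t).integrable (μ := μ))
      (BdM.comp hZ hσ.1.1.measurable).integrable
    exact ⟨_, opt_step μ 𝓕 T hZ ht hσ hD h⟩

lemma opt_local [IsProbabilityMeasure μ] {C : ℝ} {Z Z' : ℕ → Ω → ℝ} (hZ : ∀ s, BdM C (Z s))
    {t : ℕ} {σ : Ω → ℕ} (hσ : Opt μ 𝓕 T t Z' σ) {D : Set Ω} (hD : MeasurableSet[𝓕 t] D)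
    {c : Ω → ℝ} (h1 : ∀ ω ∈ D, ∀ s, t ≤ s → Z s ω = c ω)
    (h2 : ∀ ω, ω ∉ D → ∀ s, t ≤ s → Z s ω = Z' s ω) : Opt μ 𝓕 T t Z σ := by
  refine ⟨hσ.1, fun σ' hσ' A hA => ?_⟩
  refine split_le (BdM.comp hZ hσ'.1.measurable).integrable
    (BdM.comp hZ hσ.1.1.measurable).integrable (𝓕.le _ _ hD) ?_ ?_
  · refine (setInt_congr (𝓕.le t) (hA.inter hD) fun ω hω => ?_).le
    rw [h1 ω hω.2 _ (hσ'.2 ω), h1 ω hω.2 _ (hσ.1.2 ω)]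
  · have hB := hA.inter hD.compl
    rw [setInt_congr (𝓕.le t) hB (g := fun ω => Z' (σ' ω) ω)
      (fun ω hω => h2 ω hω.2 _ (hσ'.2 ω)),
      setInt_congr (𝓕.le t) hB (f := fun ω => Z (σ ω) ω) (g := fun ω => Z' (σ ω) ω)
      (fun ω hω => h2 ω hω.2 _ (hσ.1.2 ω))]
    exact hσ.2 _ hσ' _ hB

lemma exists_game [IsProbabilityMeasure μ] {C : ℝ} {X1 Y1 X2 Y2 : ℕ → Ω → ℝ}
    (hX1 : ∀ s, BdM C (X1 s)) (hY1 : ∀ s, BdM C (Y1 s))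
    (hX2 : ∀ s, BdM C (X2 s)) (hY2 : ∀ s, BdM C (Y2 s)) (t : ℕ) (ht : t ≤ T) :
    ∃ ρ τ, Opt μ 𝓕 T t (ZA X1 Y1 τ) ρ ∧ Opt μ 𝓕 T t (ZB X2 Y2 ρ) τ := by
  induction ht using Nat.decreasingInduction with
  | self => exact ⟨_, _, opt_T μ 𝓕 T _, opt_T μ 𝓕 T _⟩
  | of_succ t ht ih =>
    obtain ⟨ρ, τ, hρ, hτ⟩ := ih
    have mρ := hρ.1.1.measurable
    have mτ := hτ.1.1.measurable
    obtain ⟨DB, hDB, hB⟩ := exists_sign μ (𝓕.le t) ((hY2 t).integrable (μ := μ))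
      (BdM.comp (BdM.ZB hX2 hY2 mρ) mτ).integrable
    have mτ' := (memTge_pw 𝓕 T ht hDB hτ.1).1.measurable
    obtain ⟨DA, hDA, hA⟩ := exists_sign μ (𝓕.le t)
      ((BdM.ZA hX1 hY1 mτ' t).integrable (μ := μ))
      (BdM.comp (BdM.ZA hX1 hY1 mτ') mρ).integrable
    have mρ' := (memTge_pw 𝓕 T ht hDA hρ.1).1.measurable
    refine ⟨pw DA t ρ, pw DB t τ, ?_, ?_⟩
    · refine opt_step μ 𝓕 T (BdM.ZA hX1 hY1 mτ') ht ?_ hDA hA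
      refine opt_local μ 𝓕 T (BdM.ZA hX1 hY1 mτ') hρ (𝓕.mono (Nat.le_succ t) _ hDB)
        (c := Y1 t) ?_ ?_
      · intro ω hω s hs
        have : ¬ s ≤ t := by omega
        simp [ZA, pw_mem hω, this]
      · intro ω hω s hs
        simp [ZA, pw_not_mem hω]
    · have hZB := BdM.ZB hX2 hY2 mρ'
      refine opt_step μ 𝓕 T hZB ht ?_ hDB ?_
      · refine opt_local μ 𝓕 T hZB hτ (𝓕.mono (Nat.le_succ t) _ hDA)
          (c := X2 t) ?_ ?_
        · intro ω hω s hs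
          have : ¬ s < t := by omega
          simp [ZB, pw_mem hω, this]
        · intro ω hω s hs
          simp [ZB, pw_not_mem hω]
      · have e1 : ∀ ω ∈ DA, ZB X2 Y2 (pw DA t ρ) t ω = ZB X2 Y2 (pw DA t ρ) (τ ω) ω := by
          intro ω hω
          have h1 := hτ.1.2 ω
          have : ¬ τ ω < t := by omega
          simp [ZB, pw_mem hω, this]
        have e2 : ∀ ω ∈ DAᶜ, ZB X2 Y2 (pw DA t ρ) t ω = Y2 t ω := by
          intro ω hω
          have h1 := hρ.1.2 ω
          have : t < ρ ω := by omega
          simp [ZB, pw_not_mem hω, this]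
        have e3 : ∀ ω ∈ DAᶜ, ZB X2 Y2 (pw DA t ρ) (τ ω) ω = ZB X2 Y2 ρ (τ ω) ω := by
          intro ω hω
          simp [ZB, pw_not_mem hω]
        intro A hA'
        have hN := hA'.inter hDA.compl
        have c1 := setInt_congr (μ := μ) (𝓕.le t) (hA'.inter hDA) fun ω hω => e1 ω hω.2
        have c2 := setInt_congr (μ := μ) (𝓕.le t) hN fun ω hω => e2 ω hω.2
        have c3 := setInt_congr (μ := μ) (𝓕.le t) hN fun ω hω => e3 ω hω.2
        have i1 := (hZB t).integrable (μ := μ)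
        have i2 := (BdM.comp hZB mτ).integrable (μ := μ)
        constructor
        · intro hs
          refine split_le i2 i1 (𝓕.le _ _ hDA) c1.ge ?_
          rw [c2, c3]
          exact (hB _ hN).1 (inter_subset_left.trans hs)
        · intro hs
          refine split_le i1 i2 (𝓕.le _ _ hDA) c1.le ?_
          rw [c2, c3]
          exact (hB _ hN).2 (inter_subset_left.trans hs)

/-- the sequential-move non-zero-sum stopping game admits a Nash
equilibrium in pure stopping strategies. -/
theorem exists_nash_equilibrium_pure
    [MeasurableSpace.CountablyGenerated Ω] [IsProbabilityMeasure μ]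
    (U1 U2 : ℕ → ℕ → Ω → ℝ)
    (hU1m : ∀ s t, Measurable[𝓕 (max s t)] (U1 s t))
    (hU2m : ∀ s t, Measurable[𝓕 (max s t)] (U2 s t))
    (hU1b : ∃ C, ∀ s t ω, |U1 s t ω| ≤ C)
    (hU2b : ∃ C, ∀ s t ω, |U2 s t ω| ≤ C) :
    ∃ ρs τs : (Ω → ℕ) × (ℕ → Ω → ℕ), MemSA 𝓕 T ρs ∧ MemSB 𝓕 T τs ∧
      (∀ ρ : (Ω → ℕ) × (ℕ → Ω → ℕ), MemSA 𝓕 T ρ → w μ U1 ρ τs ≤ w μ U1 ρs τs) ∧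
      (∀ τ : (Ω → ℕ) × (ℕ → Ω → ℕ), MemSB 𝓕 T τ → w μ U2 ρs τ ≤ w μ U2 ρs τs) := by
  obtain ⟨C1, hC1⟩ := hU1b
  obtain ⟨C2, hC2⟩ := hU2b
  have b1 : ∀ s t, BdM (max C1 C2) (U1 s t) := fun s t =>
    ⟨(hU1m s t).mono (𝓕.le _) le_rfl, fun ω => (hC1 s t ω).trans (le_max_left _ _)⟩
  have b2 : ∀ s t, BdM (max C1 C2) (U2 s t) := fun s t =>
    ⟨(hU2m s t).mono (𝓕.le _) le_rfl, fun ω => (hC2 s t ω).trans (le_max_right _ _)⟩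
  have hψ : ∀ s, ∃ σ : Ω → ℕ, Measurable σ ∧ (s ≤ T → Opt μ 𝓕 T s (fun r => U2 s r) σ) := by
    intro s
    by_cases hs : s ≤ T
    · obtain ⟨σ, hσ⟩ := exists_opt μ 𝓕 T (b2 s) s hs
      exact ⟨σ, hσ.1.1.measurable, fun _ => hσ⟩
    · exact ⟨fun _ => 0, measurable_const, fun h => absurd h hs⟩
  have hφ : ∀ s, ∃ σ : Ω → ℕ, Measurable σ ∧
      (s ≤ T → Opt μ 𝓕 T (min (s+1) T) (fun r => U1 r s) σ) := by
    intro s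
    by_cases hs : s ≤ T
    · obtain ⟨σ, hσ⟩ := exists_opt μ 𝓕 T (fun r => b1 r s) (min (s+1) T) (min_le_right _ _)
      exact ⟨σ, hσ.1.1.measurable, fun _ => hσ⟩
    · exact ⟨fun _ => 0, measurable_const, fun h => absurd h hs⟩
  choose ψ mψ oψ using hψ
  choose φ mφ oφ using hφ
  have bX1 : ∀ s, BdM (max C1 C2) (fun ω => U1 s (ψ s ω) ω) := fun s => BdM.comp (b1 s) (mψ s)
  have bX2 : ∀ s, BdM (max C1 C2) (fun ω => U2 s (ψ s ω) ω) := fun s => BdM.comp (b2 s) (mψ s)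
  have bY1 : ∀ s, BdM (max C1 C2) (fun ω => U1 (φ s ω) s ω) :=
    fun s => BdM.comp (fun r => b1 r s) (mφ s)
  have bY2 : ∀ s, BdM (max C1 C2) (fun ω => U2 (φ s ω) s ω) :=
    fun s => BdM.comp (fun r => b2 r s) (mφ s)
  obtain ⟨ρ, τ, hρ, hτ⟩ := exists_game μ 𝓕 T bX1 bY1 bX2 bY2 0 (Nat.zero_le T)
  have mρ := hρ.1.1.measurable
  have mτ := hτ.1.1.measurable
  refine ⟨(ρ, φ), (τ, ψ), ⟨hρ.1.1, fun t ht => (oφ t ht).1⟩, ⟨hτ.1.1, fun t ht => (oψ t ht).1⟩,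
    ?_, ?_⟩
  · rintro ⟨ρ0, ρ1⟩ ⟨h0, h1⟩
    dsimp only at h0 h1
    have m0' := h0.measurable
    have eq1 : w μ U1 (ρ, φ) (τ, ψ) = ∫ ω, ZA (fun s ω => U1 s (ψ s ω) ω)
        (fun s ω => U1 (φ s ω) s ω) τ (ρ ω) ω ∂μ := by
      unfold w
      congr 1
      ext ω
      by_cases h : ρ ω ≤ τ ω
      · simp [adjA, adjB, ZA, h, not_lt.2 h]
      · simp [adjA, adjB, ZA, h, not_le.1 h]
    have hopt := hρ.2 ρ0 ⟨h0, fun _ => Nat.zero_le _⟩ univ MeasurableSet.univ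
    rw [setIntegral_univ, setIntegral_univ, ← eq1] at hopt
    refine le_trans ?_ hopt
    let ρ2 : ℕ → Ω → ℕ := fun s => if s ≤ T then ρ1 s else fun _ => 0
    have mρ2 : ∀ s, Measurable (ρ2 s) := by
      intro s
      by_cases hs : s ≤ T
      · simpa [ρ2, hs] using (h1 s hs).1.measurable
      · simp [ρ2, hs]
    have eq2 : w μ U1 (ρ0, ρ1) (τ, ψ) = ∫ ω, ZA (fun s ω => U1 s (ψ s ω) ω)
        (fun s ω => U1 (ρ2 s ω) s ω) τ (ρ0 ω) ω ∂μ := by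
      unfold w
      congr 1
      ext ω
      have hT := hτ.1.1.2 ω
      by_cases h : ρ0 ω ≤ τ ω
      · simp [adjA, adjB, ZA, h, not_lt.2 h]
      · simp [adjA, adjB, ZA, h, not_le.1 h, ρ2, hT]
    rw [eq2]
    have i1 := (BdM.comp (BdM.ZA bX1 (fun s => BdM.comp (fun r => b1 r s) (mρ2 s)) mτ)
      m0').integrable (μ := μ)
    have i2 := (BdM.comp (BdM.ZA bX1 bY1 mτ) m0').integrable (μ := μ)
    refine sum_le T i1 i2 mτ hτ.1.1.2 fun s hs => ?_
    have hE := hτ.1.1.meas_eq s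
    have hF := h0.meas_le (le_refl s)
    refine split_le i1 i2 (𝓕.le _ _ hF) ?_ ?_
    · refine (setInt_congr (𝓕.le s) (hE.inter hF) ?_).le
      rintro ω ⟨h2, h3⟩
      simp only [mem_ofPred_eq] at h2 h3
      simp [ZA, h2, h3]
    · have hN := hE.inter hF.compl
      have key := (oφ s hs).2 (ρ1 s) (h1 s hs) _ (𝓕.mono (le_min (Nat.le_succ s) hs) _ hN)
      refine ((setInt_congr (𝓕.le s) hN ?_).le.trans key).trans (setInt_congr (𝓕.le s) hN ?_).le
      · rintro ω ⟨h2, h3⟩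
        simp only [mem_ofPred_eq, mem_compl_iff] at h2 h3
        simp [ZA, h2, h3, ρ2, hs]
      · rintro ω ⟨h2, h3⟩
        simp only [mem_ofPred_eq, mem_compl_iff] at h2 h3
        simp [ZA, h2, h3]
  · rintro ⟨τ0, τ1⟩ ⟨h0, h1⟩
    dsimp only at h0 h1
    have m0' := h0.measurable
    have eq1 : w μ U2 (ρ, φ) (τ, ψ) = ∫ ω, ZB (fun s ω => U2 s (ψ s ω) ω)
        (fun s ω => U2 (φ s ω) s ω) ρ (τ ω) ω ∂μ := by
      unfold w
      congr 1
      ext ω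
      by_cases h : τ ω < ρ ω
      · simp [adjA, adjB, ZB, h, not_le.2 h]
      · simp [adjA, adjB, ZB, h, not_lt.1 h]
    have hopt := hτ.2 τ0 ⟨h0, fun _ => Nat.zero_le _⟩ univ MeasurableSet.univ
    rw [setIntegral_univ, setIntegral_univ, ← eq1] at hopt
    refine le_trans ?_ hopt
    let τ2 : ℕ → Ω → ℕ := fun s => if s ≤ T then τ1 s else fun _ => 0
    have mτ2 : ∀ s, Measurable (τ2 s) := by
      intro s
      by_cases hs : s ≤ T
      · simpa [τ2, hs] using (h1 s hs).1.measurable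
      · simp [τ2, hs]
    have eq2 : w μ U2 (ρ, φ) (τ0, τ1) = ∫ ω, ZB (fun s ω => U2 s (τ2 s ω) ω)
        (fun s ω => U2 (φ s ω) s ω) ρ (τ0 ω) ω ∂μ := by
      unfold w
      congr 1
      ext ω
      have hT := hρ.1.1.2 ω
      by_cases h : τ0 ω < ρ ω
      · simp [adjA, adjB, ZB, h, not_le.2 h]
      · simp [adjA, adjB, ZB, h, not_lt.1 h, τ2, hT]
    rw [eq2]
    have i1 := (BdM.comp (BdM.ZB (fun s => BdM.comp (b2 s) (mτ2 s)) bY2 mρ)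
      m0').integrable (μ := μ)
    have i2 := (BdM.comp (BdM.ZB bX2 bY2 mρ) m0').integrable (μ := μ)
    refine sum_le T i1 i2 mρ hρ.1.1.2 fun s hs => ?_
    have hE := hρ.1.1.meas_eq s
    have hF : MeasurableSet[𝓕 s] {ω | τ0 ω < s} := by
      convert (h0.meas_le (le_refl s)).diff (h0.meas_eq s) using 1
      ext ω; simp; omega
    refine split_le i1 i2 (𝓕.le _ _ hF) ?_ ?_
    · refine (setInt_congr (𝓕.le s) (hE.inter hF) ?_).le
      rintro ω ⟨h2, h3⟩
      simp only [mem_ofPred_eq] at h2 h3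
      simp [ZB, h2, h3]
    · have hN := hE.inter hF.compl
      have key := (oψ s hs).2 (τ1 s) (h1 s hs) _ hN
      refine ((setInt_congr (𝓕.le s) hN ?_).le.trans key).trans (setInt_congr (𝓕.le s) hN ?_).le
      · rintro ω ⟨h2, h3⟩
        simp only [mem_ofPred_eq, mem_compl_iff] at h2 h3
        simp [ZB, h2, h3, τ2, hs]
      · rintro ω ⟨h2, h3⟩
        simp only [mem_ofPred_eq, mem_compl_iff] at h2 h3
        simp [ZB, h2, h3]

end
end

section
/- In the zero-sum sequential-move stopping game, with ρ*_σ := (ρ_σ, ρ̃) ∈ 𝔗^a_σ and τ*_σ := (τ_σ, τ̃) ∈ 𝔗^b_σ as constructed, for every type-B strategy τ = (τ_0, τ_1) ∈ 𝔗^b_σ one has E_σ[U(ρ*_σ⟨τ⟩, τ⟨ρ*_σ⟩)] ≥ E_σ[U(ρ*_σ⟨τ*_σ⟩, τ*_σ⟨ρ*_σ⟩)] almost surely. -/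
open MeasureTheory Set

section

variable {Ω : Type*} {m0 : MeasurableSpace Ω} (μ : Measure Ω) (𝓕 : Filtration ℕ m0) (T : ℕ)

/-- Conditional expectations agree on an `m`-measurable set on which the functions agree. -/
theorem aux_condExp_local {μ : Measure Ω} [IsProbabilityMeasure μ] {m : MeasurableSpace Ω}
    (hm : m ≤ m0) {f g : Ω → ℝ} (hf : Integrable f μ) (hg : Integrable g μ) {S : Set Ω}
    (hS : MeasurableSet[m] S) (hfg : ∀ ω ∈ S, f ω = g ω) :
    ∀ᵐ ω ∂μ, ω ∈ S → (μ[f | m]) ω = (μ[g | m]) ω := by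
  have h1 := condExp_indicator (m := m) hf hS
  have h2 := condExp_indicator (m := m) hg hS
  have he : S.indicator f = S.indicator g := Set.indicator_congr hfg
  rw [he] at h1
  filter_upwards [h1, h2] with ω h1 h2 hω
  rw [h1] at h2
  simpa [hω] using h2

/-- Local monotonicity of conditional expectation. -/
theorem aux_condExp_local_le {μ : Measure Ω} [IsProbabilityMeasure μ] {m : MeasurableSpace Ω}
    (hm : m ≤ m0) {f g : Ω → ℝ} (hf : Integrable f μ) (hg : Integrable g μ) {S : Set Ω}
    (hS : MeasurableSet[m] S) (hfg : ∀ᵐ ω ∂μ, ω ∈ S → f ω ≤ g ω) :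
    ∀ᵐ ω ∂μ, ω ∈ S → (μ[f | m]) ω ≤ (μ[g | m]) ω := by
  have h1 := condExp_indicator (m := m) hf hS
  have h2 := condExp_indicator (m := m) hg hS
  have h3 : μ[S.indicator f | m] ≤ᵐ[μ] μ[S.indicator g | m] := by
    apply condExp_mono (hf.indicator (hm _ hS)) (hg.indicator (hm _ hS))
    filter_upwards [hfg] with ω h
    by_cases hω : ω ∈ S
    · simpa [hω] using h hω
    · simp [hω]
  filter_upwards [h1, h2, h3] with ω h1 h2 h3 hω
  rw [h1, h2] at h3
  simpa [hω] using h3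

/-- Backward induction: a process which is a submartingale before `θ` and is dominated at `θ`
by the conditional payoff is dominated before. -/
theorem aux_back {μ : Measure Ω} [IsProbabilityMeasure μ] (𝓕 : Filtration ℕ m0) (T : ℕ)
    (v : ℕ → Ω → ℝ) (R : Ω → ℝ) (σ θ : Ω → ℕ) (hθT : ∀ ω, θ ω ≤ T)
    (hB : ∀ t < T, MeasurableSet[𝓕 t] {ω | σ ω ≤ t ∧ t < θ ω})
    (hv : ∀ t ≤ T, Integrable (v t) μ) (hR : Integrable R μ)
    (ha : ∀ t ≤ T, ∀ᵐ ω ∂μ, σ ω ≤ t → θ ω = t → v t ω ≤ (μ[R | 𝓕 t]) ω)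
    (hb : ∀ t < T, ∀ᵐ ω ∂μ, σ ω ≤ t → t < θ ω → v t ω ≤ (μ[v (t + 1) | 𝓕 t]) ω) :
    ∀ t ≤ T, ∀ᵐ ω ∂μ, σ ω ≤ t → t ≤ θ ω → v t ω ≤ (μ[R | 𝓕 t]) ω := by
  intro t ht
  induction ht using Nat.decreasingInduction with
  | self =>
    filter_upwards [ha T le_rfl] with ω h h1 h2
    exact h h1 (le_antisymm (hθT ω) h2)
  | of_succ t ht ih =>
    have h1 := aux_condExp_local_le (𝓕.le t) (hv (t + 1) ht)
      (integrable_condExp (m := 𝓕 (t + 1)) (f := R) (μ := μ)) (hB t ht) (by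
        filter_upwards [ih] with ω h hω
        exact h (by have := hω.1; omega) (by have := hω.2; omega))
    have h2 : μ[μ[R | 𝓕 (t + 1)] | 𝓕 t] =ᵐ[μ] μ[R | 𝓕 t] :=
      condExp_condExp_of_le (𝓕.mono (Nat.le_succ t)) (𝓕.le _)
    filter_upwards [h1, h2, ha t ht.le, hb t ht] with ω h1 h2 h3 h4 h5 h6
    rcases h6.eq_or_lt with h7 | h7
    · exact h3 h5 h7.symm
    · have := h1 ⟨h5, h7⟩
      rw [h2] at this
      exact (h4 h5 h7).trans this

theorem aux_hit_le (T : ℕ) (σ : Ω → ℕ) (P : ℕ → Ω → Prop) (ω : Ω) : hitTime T σ P ω ≤ T :=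
  Nat.sInf_le (Or.inr rfl)

theorem aux_hit_mem (T : ℕ) (σ : Ω → ℕ) (P : ℕ → Ω → Prop) (ω : Ω) :
    (σ ω ≤ hitTime T σ P ω ∧ P (hitTime T σ P ω) ω) ∨ hitTime T σ P ω = T := by
  have : hitTime T σ P ω ∈ ({t | σ ω ≤ t ∧ P t ω} ∪ {T} : Set ℕ) :=
    Nat.sInf_mem ⟨T, Or.inr rfl⟩
  exact this

theorem aux_hit_not (T : ℕ) (σ : Ω → ℕ) (P : ℕ → Ω → Prop) (ω : Ω) (t : ℕ)
    (h : t < hitTime T σ P ω) (hs : σ ω ≤ t) : ¬ P t ω := by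
  intro hp
  have : hitTime T σ P ω ≤ t := Nat.sInf_le (Or.inl ⟨hs, hp⟩)
  omega

theorem aux_stop_le {σ : Ω → ℕ} (hσ : IsStoppingTime 𝓕 (fun ω => (σ ω : WithTop ℕ))) (t : ℕ) :
    MeasurableSet[𝓕 t] {ω | σ ω ≤ t} := by
  have := hσ t
  simpa using this

theorem aux_hit_meas (σ : Ω → ℕ) (hσ : ∀ t, MeasurableSet[𝓕 t] {ω | σ ω ≤ t})
    (P : ℕ → Ω → Prop) (hP : ∀ t < T, MeasurableSet[𝓕 t] {ω | P t ω}) (t : ℕ) :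
    MeasurableSet[𝓕 t] {ω | hitTime T σ P ω ≤ t} := by
  by_cases ht : T ≤ t
  · have : {ω | hitTime T σ P ω ≤ t} = Set.univ :=
      Set.eq_univ_of_forall fun ω => (aux_hit_le T σ P ω).trans ht
    rw [this]; exact MeasurableSet.univ
  · have : {ω | hitTime T σ P ω ≤ t} = ⋃ s ∈ Set.Iic t, ({ω | σ ω ≤ s} ∩ {ω | P s ω}) := by
      ext ω
      simp only [Set.mem_ofPred_eq, Set.mem_iUnion, Set.mem_inter_iff, Set.mem_Iic, exists_prop]
      constructor
      · intro h
        rcases aux_hit_mem T σ P ω with h1 | h1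
        · exact ⟨_, h, h1⟩
        · omega
      · rintro ⟨s, hs, h1⟩
        exact (Nat.sInf_le (Or.inl h1)).trans hs
    rw [this]
    refine MeasurableSet.biUnion (Set.to_countable _) fun s hs => ?_
    have hs' : s ≤ t := hs
    exact 𝓕.mono hs' _ ((hσ s).inter (hP s (by omega)))

theorem aux_meas_nat {θ : Ω → ℕ} (h : ∀ t, MeasurableSet[𝓕 t] {ω | θ ω ≤ t}) :
    Measurable θ :=
  measurable_of_Iic fun t => 𝓕.le t _ (h t)

theorem aux_meas_comp_s6 {U : ℕ → Ω → ℕ} (hU : ∀ t ≤ T, Measurable (U t)) {a : Ω → ℕ}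
    (ha : Measurable a) (haT : ∀ ω, a ω ≤ T) : Measurable (fun ω => U (a ω) ω) := by
  have h : (fun ω => U (a ω) ω)
      = (fun p : ℕ × Ω => U (min p.1 T) p.2) ∘ (fun ω => (a ω, ω)) := by
    funext ω
    simp [min_eq_left (haT ω)]
  rw [h]
  refine Measurable.comp ?_ (ha.prodMk measurable_id)
  exact measurable_from_prod_countable_right fun n => hU _ (min_le_right _ _)

theorem aux_int_s6 {μ : Measure Ω} [IsProbabilityMeasure μ] {U : ℕ → ℕ → Ω → ℝ}
    (hUm : ∀ s t, Measurable[𝓕 (max s t)] (U s t))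
    (hUb : ∃ C, ∀ s t ω, |U s t ω| ≤ C) {a b : Ω → ℕ} (ha : Measurable a) (hb : Measurable b) :
    Integrable (fun ω => U (a ω) (b ω) ω) μ := by
  obtain ⟨C, hC⟩ := hUb
  have hm : Measurable (fun ω => U (a ω) (b ω) ω) := by
    have h : (fun ω => U (a ω) (b ω) ω)
        = (fun p : (ℕ × ℕ) × Ω => U p.1.1 p.1.2 p.2) ∘ (fun ω => ((a ω, b ω), ω)) := rfl
    rw [h]
    refine Measurable.comp ?_ ((ha.prodMk hb).prodMk measurable_id)
    exact measurable_from_prod_countable_right fun n => (hUm n.1 n.2).mono (𝓕.le _) le_rfl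
  exact Integrable.of_bound hm.aestronglyMeasurable C (Filter.Eventually.of_forall fun ω => hC _ _ _)

/-- The conditional payoff at `ρ₀ ∧ τ₀`. -/
theorem aux_payoff {μ : Measure Ω} [IsProbabilityMeasure μ] {U : ℕ → ℕ → Ω → ℝ}
    (hUm : ∀ s t, Measurable[𝓕 (max s t)] (U s t))
    (hUb : ∃ C, ∀ s t ω, |U s t ω| ≤ C) (ρ τ : (Ω → ℕ) × (ℕ → Ω → ℕ))
    (hρ0 : ∀ t, MeasurableSet[𝓕 t] {ω | ρ.1 ω ≤ t}) (hτ0 : ∀ t, MeasurableSet[𝓕 t] {ω | τ.1 ω ≤ t})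
    (hρT : ∀ ω, ρ.1 ω ≤ T) (hτT : ∀ ω, τ.1 ω ≤ T)
    (hρ1 : ∀ t ≤ T, Measurable (ρ.2 t)) (hτ1 : ∀ t ≤ T, Measurable (τ.2 t)) :
    Integrable (fun ω => U (adjA ρ τ ω) (adjB τ ρ ω) ω) μ ∧
    ∀ t ≤ T, ∀ᵐ ω ∂μ, min (ρ.1 ω) (τ.1 ω) = t →
      (ρ.1 ω ≤ τ.1 ω ∧ ρ.1 ω = t ∧
        (μ[fun ω => U (adjA ρ τ ω) (adjB τ ρ ω) ω | 𝓕 t]) ω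
          = (μ[fun ω => U t (τ.2 t ω) ω | 𝓕 t]) ω) ∨
      (τ.1 ω < ρ.1 ω ∧ τ.1 ω = t ∧
        (μ[fun ω => U (adjA ρ τ ω) (adjB τ ρ ω) ω | 𝓕 t]) ω
          = (μ[fun ω => U (ρ.2 t ω) t ω | 𝓕 t]) ω) := by
  have mρ := aux_meas_nat 𝓕 hρ0
  have mτ := aux_meas_nat 𝓕 hτ0
  have hR : Integrable (fun ω => U (adjA ρ τ ω) (adjB τ ρ ω) ω) μ := by
    refine aux_int_s6 𝓕 hUm hUb ?_ ?_
    · exact Measurable.ite (measurableSet_le mρ mτ) mρ (aux_meas_comp_s6 T hρ1 mτ hτT)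
    · exact Measurable.ite (measurableSet_lt mτ mρ) mτ (aux_meas_comp_s6 T hτ1 mρ hρT)
  refine ⟨hR, fun t ht => ?_⟩
  have lt_meas : ∀ {θ : Ω → ℕ}, (∀ t, MeasurableSet[𝓕 t] {ω | θ ω ≤ t}) →
      MeasurableSet[𝓕 t] {ω | θ ω < t} := by
    intro θ h
    rcases t with _ | t
    · simp
    · have h1 := 𝓕.mono (Nat.le_succ t) _ (h t)
      have h2 : {ω | θ ω < t + 1} = {ω | θ ω ≤ t} := by ext; simp [Nat.lt_succ_iff]
      rw [h2]; exact h1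
  have S1 : MeasurableSet[𝓕 t] {ω | ρ.1 ω = t ∧ t ≤ τ.1 ω} := by
    have : {ω | ρ.1 ω = t ∧ t ≤ τ.1 ω} = ({ω | ρ.1 ω ≤ t} \ {ω | ρ.1 ω < t}) \ {ω | τ.1 ω < t} := by
      ext ω; simp only [Set.mem_ofPred_eq, Set.mem_sdiff]; omega
    rw [this]; exact ((hρ0 t).diff (lt_meas hρ0)).diff (lt_meas hτ0)
  have S2 : MeasurableSet[𝓕 t] {ω | τ.1 ω = t ∧ t < ρ.1 ω} := by
    have : {ω | τ.1 ω = t ∧ t < ρ.1 ω} = ({ω | τ.1 ω ≤ t} \ {ω | τ.1 ω < t}) \ {ω | ρ.1 ω ≤ t} := by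
      ext ω; simp only [Set.mem_ofPred_eq, Set.mem_sdiff]; omega
    rw [this]; exact ((hτ0 t).diff (lt_meas hτ0)).diff (hρ0 t)
  have h1 := aux_condExp_local (𝓕.le t) hR
    (aux_int_s6 (μ := μ) 𝓕 hUm hUb (measurable_const (a := t)) (hτ1 t ht)) S1 (by
      rintro ω ⟨h1, h2⟩
      have h3 : ρ.1 ω ≤ τ.1 ω := by omega
      simp [adjA, adjB, h3, not_lt.mpr h3]
      rw [h1])
  have h2 := aux_condExp_local (𝓕.le t) hR
    (aux_int_s6 (μ := μ) 𝓕 hUm hUb (hρ1 t ht) (measurable_const (a := t))) S2 (by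
      rintro ω ⟨h1, h2⟩
      have h3 : τ.1 ω < ρ.1 ω := by omega
      simp [adjA, adjB, h3, not_le.mpr h3]
      rw [h1])
  filter_upwards [h1, h2] with ω h1 h2 h
  by_cases h3 : ρ.1 ω ≤ τ.1 ω
  · rw [min_eq_left h3] at h
    exact Or.inl ⟨h3, h, h1 ⟨h, by omega⟩⟩
  · rw [min_eq_right (by omega)] at h
    exact Or.inr ⟨by omega, h, h2 ⟨h, by omega⟩⟩

/-- in the zero-sum sequential-move stopping game, for every
type-B strategy `τ ∈ 𝔗^b_σ`, the conditional payoff against the constructed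
strategy `ρ*_σ = (ρ_σ, ρ̃)` dominates the equilibrium conditional payoff:
`E_σ[U(ρ*_σ⟨τ⟩, τ⟨ρ*_σ⟩)] ≥ E_σ[U(ρ*_σ⟨τ*_σ⟩, τ*_σ⟨ρ*_σ⟩)]` a.s. -/
theorem zero_sum_saddle_second_player_deviation
    [MeasurableSpace.CountablyGenerated Ω] [IsProbabilityMeasure μ]
    (U : ℕ → ℕ → Ω → ℝ)
    (hUm : ∀ s t, Measurable[𝓕 (max s t)] (U s t))
    (hUb : ∃ C, ∀ s t ω, |U s t ω| ≤ C)
    -- stage-wise optimizers `ρ̃(t) ∈ 𝒯_{t+}` and `τ̃(t) ∈ 𝒯_t`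
    (ρtil τtil : ℕ → Ω → ℕ)
    (hρtil : ∀ t ≤ T, MemTgePlus 𝓕 T t (ρtil t))
    (hτtil : ∀ t ≤ T, MemTge 𝓕 T t (τtil t))
    (hρopt : ∀ t ≤ T, ∀ ξ : Ω → ℕ, MemTgePlus 𝓕 T t ξ →
      μ[fun ω => U (ξ ω) t ω | 𝓕 t] ≤ᵐ[μ] μ[fun ω => U (ρtil t ω) t ω | 𝓕 t])
    (hτopt : ∀ t ≤ T, ∀ ξ : Ω → ℕ, MemTge 𝓕 T t ξ →
      μ[fun ω => U t (τtil t ω) ω | 𝓕 t] ≤ᵐ[μ] μ[fun ω => U t (ξ ω) ω | 𝓕 t])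
    -- `F_t = E_t[U(t,τ̃(t))]`, `G_t = E_t[U(ρ̃(t),t)] ∨ F_t`
    (F G v : ℕ → Ω → ℝ)
    (hF : ∀ t, F t = μ[fun ω => U t (τtil t ω) ω | 𝓕 t])
    (hG : ∀ t, G t = fun ω => max ((μ[fun ω' => U (ρtil t ω') t ω' | 𝓕 t]) ω) (F t ω))
    -- the value process, by backward recursion
    (hvT : v T = F T)
    (hvrec : ∀ t < T, v t = fun ω => max (F t ω) (min (G t ω) ((μ[v (t + 1) | 𝓕 t]) ω)))
    -- the initial stage `σ ∈ 𝒯`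
    (σ : Ω → ℕ) (hσ : IsStoppingTime 𝓕 (fun ω => (σ ω : WithTop ℕ))) (hσT : ∀ ω, σ ω ≤ T)
    -- `ρ_σ = inf{t ≥ σ : v_t = F_t}` and `τ_σ = inf{t ≥ σ : v_t = G_t}`
    (ρσ τσ : Ω → ℕ)
    (hρσ : ρσ = hitTime T σ (fun t ω => v t ω = F t ω))
    (hτσ : τσ = hitTime T σ (fun t ω => v t ω = G t ω))
    -- an arbitrary deviation `τ ∈ 𝔗^b_σ` of the second player
    (τ : (Ω → ℕ) × (ℕ → Ω → ℕ)) (hτ : MemSB 𝓕 T τ) (hτge : ∀ ω, σ ω ≤ τ.1 ω) :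
    μ[fun ω => U (adjA (ρσ, ρtil) (τσ, τtil) ω) (adjB (τσ, τtil) (ρσ, ρtil) ω) ω
        | hσ.measurableSpace] ≤ᵐ[μ]
    μ[fun ω => U (adjA (ρσ, ρtil) τ ω) (adjB τ (ρσ, ρtil) ω) ω
        | hσ.measurableSpace] := by
  have hσm := aux_stop_le 𝓕 hσ
  have mρt : ∀ t ≤ T, Measurable (ρtil t) := fun t ht =>
    aux_meas_nat 𝓕 (aux_stop_le 𝓕 (hρtil t ht).1.1)
  have mτt : ∀ t ≤ T, Measurable (τtil t) := fun t ht =>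
    aux_meas_nat 𝓕 (aux_stop_le 𝓕 (hτtil t ht).1.1)
  have sF : ∀ t, StronglyMeasurable[𝓕 t] (F t) := fun t => by
    rw [hF]; exact stronglyMeasurable_condExp
  have iF : ∀ t, Integrable (F t) μ := fun t => by
    rw [hF]; exact integrable_condExp
  have sG : ∀ t, StronglyMeasurable[𝓕 t] (G t) := fun t => by
    rw [hG]; exact @StronglyMeasurable.sup _ _ _ _ (𝓕 t) _ _ _ stronglyMeasurable_condExp (sF t)
  have iG : ∀ t, Integrable (G t) μ := fun t => by
    rw [hG]; exact integrable_condExp.sup (iF t)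
  have sv : ∀ t ≤ T, StronglyMeasurable[𝓕 t] (v t) := by
    intro t ht
    rcases ht.eq_or_lt with h | h
    · subst h; rw [hvT]; exact sF _
    · rw [hvrec t h]; exact @StronglyMeasurable.sup _ _ _ _ (𝓕 t) _ _ _ (sF t)
        (@StronglyMeasurable.inf _ _ _ _ (𝓕 t) _ _ _ (sG t) stronglyMeasurable_condExp)
  have iv : ∀ t ≤ T, Integrable (v t) μ := by
    intro t ht
    rcases ht.eq_or_lt with h | h
    · subst h; rw [hvT]; exact iF _
    · rw [hvrec t h]; exact (iF t).sup ((iG t).inf integrable_condExp)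
  have hρ0 : ∀ t, MeasurableSet[𝓕 t] {ω | ρσ ω ≤ t} := by
    rw [hρσ]
    exact aux_hit_meas 𝓕 T σ hσm _ fun t ht =>
      StronglyMeasurable.measurableSet_eq_fun (sv t ht.le) (sF t)
  have hτ0 : ∀ t, MeasurableSet[𝓕 t] {ω | τσ ω ≤ t} := by
    rw [hτσ]
    exact aux_hit_meas 𝓕 T σ hσm _ fun t ht =>
      StronglyMeasurable.measurableSet_eq_fun (sv t ht.le) (sG t)
  have hρT : ∀ ω, ρσ ω ≤ T := fun ω => by rw [hρσ]; exact aux_hit_le _ _ _ _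
  have hτT : ∀ ω, τσ ω ≤ T := fun ω => by rw [hτσ]; exact aux_hit_le _ _ _ _
  have hσρ : ∀ ω, σ ω ≤ ρσ ω := fun ω => by
    have := aux_hit_mem T σ (fun t ω => v t ω = F t ω) ω
    rw [← hρσ] at this
    have := hσT ω
    omega
  have hστ : ∀ ω, σ ω ≤ τσ ω := fun ω => by
    have := aux_hit_mem T σ (fun t ω => v t ω = G t ω) ω
    rw [← hτσ] at this
    have := hσT ω
    omega
  have vρ : ∀ ω, v (ρσ ω) ω = F (ρσ ω) ω := fun ω => by
    have := aux_hit_mem T σ (fun t ω => v t ω = F t ω) ω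
    rw [← hρσ] at this
    rcases this with h | h
    · exact h.2
    · rw [h, hvT]
  have vτ : ∀ ω, τσ ω < T → v (τσ ω) ω = G (τσ ω) ω := fun ω hlt => by
    have := aux_hit_mem T σ (fun t ω => v t ω = G t ω) ω
    rw [← hτσ] at this
    rcases this with h | h
    · exact h.2
    · omega
  have nρ : ∀ ω t, t < ρσ ω → σ ω ≤ t → v t ω ≠ F t ω := fun ω t h1 h2 => by
    rw [hρσ] at h1; exact aux_hit_not T σ _ ω t h1 h2
  have nτ : ∀ ω t, t < τσ ω → σ ω ≤ t → v t ω ≠ G t ω := fun ω t h1 h2 => by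
    rw [hτσ] at h1; exact aux_hit_not T σ _ ω t h1 h2
  have vr : ∀ t < T, ∀ ω, v t ω = max (F t ω) (min (G t ω) ((μ[v (t + 1) | 𝓕 t]) ω)) :=
    fun t ht ω => congrFun (hvrec t ht) ω
  have Gr : ∀ t ω, G t ω = max ((μ[fun ω' => U (ρtil t ω') t ω' | 𝓕 t]) ω) (F t ω) :=
    fun t ω => congrFun (hG t) ω
  have hBm : ∀ {a b : Ω → ℕ}, (∀ t, MeasurableSet[𝓕 t] {ω | a ω ≤ t}) →
      (∀ t, MeasurableSet[𝓕 t] {ω | b ω ≤ t}) →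
      ∀ t < T, MeasurableSet[𝓕 t] {ω | σ ω ≤ t ∧ t < min (a ω) (b ω)} := by
    intro a b ha hb t _
    have : {ω | σ ω ≤ t ∧ t < min (a ω) (b ω)}
        = ({ω | σ ω ≤ t} \ {ω | a ω ≤ t}) \ {ω | b ω ≤ t} := by
      ext ω; simp only [Set.mem_ofPred_eq, Set.mem_sdiff, lt_min_iff]; omega
    rw [this]; exact ((hσm t).diff (ha t)).diff (hb t)
  have hτ'0 := aux_stop_le 𝓕 hτ.1.1
  have mτ1 : ∀ t ≤ T, Measurable (τ.2 t) := fun t ht =>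
    aux_meas_nat 𝓕 (aux_stop_le 𝓕 (hτ.2 t ht).1.1)
  obtain ⟨iR, pR⟩ := aux_payoff 𝓕 T (μ := μ) hUm hUb (ρσ, ρtil) τ hρ0 hτ'0 hρT hτ.1.2 mρt mτ1
  obtain ⟨iS, pS⟩ := aux_payoff 𝓕 T (μ := μ) hUm hUb (ρσ, ρtil) (τσ, τtil) hρ0 hτ0 hρT hτT mρt mτt
  set R : Ω → ℝ := fun ω => U (adjA (ρσ, ρtil) τ ω) (adjB τ (ρσ, ρtil) ω) ω with hRdef
  set S : Ω → ℝ := fun ω => U (adjA (ρσ, ρtil) (τσ, τtil) ω) (adjB (τσ, τtil) (ρσ, ρtil) ω) ω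
    with hSdef
  -- lower bound
  have L := aux_back 𝓕 T v R σ (fun ω => min (ρσ ω) (τ.1 ω)) (fun ω => min_le_of_left_le (hρT ω))
    (hBm hρ0 hτ'0) iv iR (by
      intro t ht
      filter_upwards [pR t ht, hτopt t ht (τ.2 t) (hτ.2 t ht)] with ω h1 h2 h3 h4
      rcases h1 h4 with ⟨_, h6, h7⟩ | ⟨h5, h6, h7⟩
      · rw [h7]
        have h8 := vρ ω
        rw [h6] at h8
        rw [h8, hF]
        exact h2
      · rw [h7]
        have h8 := nρ ω t (by omega) h3
        have h9 := vr t (by have := hρT ω; omega) ω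
        have h10 := Gr t ω
        grind) (by
      intro t ht
      refine Filter.Eventually.of_forall fun ω h1 h2 => ?_
      have h8 := nρ ω t (lt_of_lt_of_le h2 (min_le_left _ _)) h1
      have h9 := vr t ht ω
      grind)
  -- upper bound
  have M := aux_back 𝓕 T (fun t => - v t) (-S) σ (fun ω => min (ρσ ω) (τσ ω))
    (fun ω => min_le_of_left_le (hρT ω))
    (hBm hρ0 hτ0) (fun t ht => (iv t ht).neg) iS.neg (by
      intro t ht
      filter_upwards [pS t ht, condExp_neg (μ := μ) S (𝓕 t)] with ω h1 h2 h3 h4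
      rw [h2]
      simp only [Pi.neg_apply, neg_le_neg_iff]
      rcases h1 h4 with ⟨_, h6, h7⟩ | ⟨h5, h6, h7⟩
      · rw [h7]
        have h8 := vρ ω
        rw [h6] at h8
        rw [h8, hF]
      · rw [h7]
        have h8 := vτ ω (by have := hρT ω; omega)
        rw [h6, Gr] at h8
        rw [h8]
        exact le_max_left _ _) (by
      intro t ht
      filter_upwards [condExp_neg (μ := μ) (v (t + 1)) (𝓕 t)] with ω h0 h1 h2
      rw [h0]
      simp only [Pi.neg_apply, neg_le_neg_iff]
      have h8 := nτ ω t (lt_of_lt_of_le h2 (min_le_right _ _)) h1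
      have h9 := vr t ht ω
      have h10 := Gr t ω
      grind)
  have K : ∀ t ≤ T, ∀ᵐ ω ∂μ, σ ω = t →
      (μ[S | hσ.measurableSpace]) ω ≤ (μ[R | hσ.measurableSpace]) ω := by
    intro t ht
    have ms : MeasurableSet {ω | (σ ω : WithTop ℕ) = (t : WithTop ℕ)} :=
      𝓕.le t _ (hσ.measurableSet_eq t)
    have e1 := condExp_stopping_time_ae_eq_restrict_eq (μ := μ) (f := R) hσ t
    have e2 := condExp_stopping_time_ae_eq_restrict_eq (μ := μ) (f := S) hσ t
    replace e1 := (ae_restrict_iff' ms).1 e1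
    replace e2 := (ae_restrict_iff' ms).1 e2
    filter_upwards [e1, e2, L t ht, M t ht, condExp_neg (μ := μ) S (𝓕 t)] with ω e1 e2 l m n h
    have hmem : ω ∈ {ω | (σ ω : WithTop ℕ) = (t : WithTop ℕ)} := by simp [h]
    rw [e1 hmem, e2 hmem]
    have l1 := l h.le (le_min (h ▸ hσρ ω) (h ▸ hτge ω))
    have m1 := m h.le (le_min (h ▸ hσρ ω) (h ▸ hστ ω))
    rw [n] at m1
    simp only [Pi.neg_apply, neg_le_neg_iff] at m1
    exact m1.trans l1
  have K2 : ∀ᵐ ω ∂μ, ∀ t, t ≤ T → σ ω = t →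
      (μ[S | hσ.measurableSpace]) ω ≤ (μ[R | hσ.measurableSpace]) ω := by
    rw [ae_all_iff]
    intro t
    by_cases ht : t ≤ T
    · filter_upwards [K t ht] with ω h _ using h
    · exact Filter.Eventually.of_forall fun ω h => absurd h ht
  filter_upwards [K2] with ω h
  exact h (σ ω) (hσT ω) rfl

end
end
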